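/- Let d ≥ 4, fix an appropriate family (ρ_n) and a constant K > 0, and set R_n = ⌊√(μ_1(ρ_n))⌋. There exists C < ∞ such that for all sufficiently large n and all y, z ∈ ℤ^d, if X¹ and X² are independent simple random walks started from y and z respectively, then E[ φ^{(ρ_n)}( X¹[0, ⌊K·R_n²⌋] , X²[0, ⌊K·R_n²⌋] ) ] ≤ C·R_n²·log^{-2}R_n if d = 4, ≤ C·R_n if d = 5, ≤ C·log R_n if d = 6, and ≤ C if d > 6. -/

import Mathlib

open MeasureTheory ProbabilityTheory Filter Topology
open scoped ENNReal NNReal Classical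

noncomputable section

namespace FRIPaper

/-- The lattice `ℤ^d`. -/
abbrev Zd (d : ℕ) := Fin d → ℤ

/-- `x` and `y` are nearest neighbours in `ℤ^d` (`ℓ¹`-distance one). -/
def IsNN {d : ℕ} (x y : Zd d) : Prop := (∑ i, (x i - y i).natAbs) = 1

/-- Event that a one-sided path never visits `A` at a positive time
(i.e. `H̃_A = ∞` for the path started anywhere). -/
def NoReturn {d : ℕ} (A : Set (Zd d)) : Set (ℕ → Zd d) := {ω | ∀ t : ℕ, 0 < t → ω t ∉ A}

/-- Event that a one-sided path does not visit `A` at a positive time `t ≤ s`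
(i.e. `H̃_A > s`). -/
def NoReturnUpTo {d : ℕ} (A : Set (Zd d)) (s : ℝ) : Set (ℕ → Zd d) :=
  {ω | ∀ t : ℕ, 0 < t → (t : ℝ) ≤ s → ω t ∉ A}

/-- Specification of the law `P^x` of the discrete-time simple random walk on `ℤ^d`
started at `x`, as a measure on the path space `ℕ → ℤ^d`: it is the unique probability
measure giving each nearest-neighbour cylinder of length `T` based at `x`
probability `(2d)^{-T}`. -/
def IsSRW (d : ℕ) (x : Zd d) (P : Measure (ℕ → Zd d)) : Prop :=
  IsProbabilityMeasure P ∧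
    ∀ (T : ℕ) (w : ℕ → Zd d),
      P {ω | ∀ t ≤ T, ω t = w t} =
        if w 0 = x ∧ ∀ t < T, IsNN (w t) (w (t + 1)) then
          (((2 * d : ℕ) : ℝ≥0∞))⁻¹ ^ T else 0

/-- A family `P x`, `x ∈ ℤ^d`, of simple random walk laws. -/
def IsSRWFamily (d : ℕ) (P : Zd d → Measure (ℕ → Zd d)) : Prop := ∀ x, IsSRW d x (P x)

/-- Equilibrium measure `e_A(x) = P^x[H̃_A = ∞] 1_{x ∈ A}`. -/
def equil {d : ℕ} (P : Zd d → Measure (ℕ → Zd d)) (A : Set (Zd d)) (x : Zd d) : ℝ :=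
  if x ∈ A then (P x (NoReturn A)).toReal else 0

/-- Capacity `cap(A) = Σ_{x∈A} e_A(x)`. -/
def capacity {d : ℕ} (P : Zd d → Measure (ℕ → Zd d)) (A : Finset (Zd d)) : ℝ :=
  ∑ x ∈ A, equil P (↑A) x

/-- Truncated capacity `cap(A,T) = Σ_{x∈A} P^x[H̃_A > T·(log T)^{-10}]`. -/
def capTrunc {d : ℕ} (P : Zd d → Measure (ℕ → Zd d)) (A : Finset (Zd d)) (T : ℝ) : ℝ :=
  ∑ x ∈ A, (P x (NoReturnUpTo (↑A) (T / (Real.log T) ^ (10 : ℕ)))).toReal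

/-- `X[a,b]`, the set of points visited by the path between times `a` and `b`. -/
def walkRange {d : ℕ} (ω : ℕ → Zd d) (a b : ℕ) : Finset (Zd d) := (Finset.Icc a b).image ω

/-- `E^0[cap(X[0,T])]`. -/
def capExpect {d : ℕ} (P : Zd d → Measure (ℕ → Zd d)) (T : ℕ) : ℝ :=
  ∫ ω, capacity P (walkRange ω 0 T) ∂ (P 0)

/-- `1 + log x · 1_{d = 4}`. -/
def logFour (d : ℕ) (x : ℝ) : ℝ := 1 + if d = 4 then Real.log x else 0

/-- `ε` is the constant `ε_d = lim_{T→∞} E^0[cap(X[0,T])]·T^{-1}·(1 + log T·1_{d=4})`,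
which lies in `(0,∞)`. -/
def IsCapLimit (d : ℕ) (P : Zd d → Measure (ℕ → Zd d)) (ε : ℝ) : Prop :=
  0 < ε ∧ Tendsto (fun T : ℕ => capExpect P T * logFour d T / (T : ℝ)) atTop (𝓝 ε)

/-! ### Distributions on `ℕ` -/

/-- `ρ` is a probability distribution on `ℕ`. -/
def IsDist (ρ : ℕ → ℝ) : Prop := (∀ k, 0 ≤ ρ k) ∧ HasSum ρ 1

/-- `k`-th moment `μ_k(ρ)`. -/
def mu (k : ℕ) (ρ : ℕ → ℝ) : ℝ := ∑' l : ℕ, (l : ℝ) ^ k * ρ l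

/-- Tail `μ_k^{(m)}(ρ) = Σ_{l ≥ m} l^k ρ(l)`. -/
def muTail (k m : ℕ) (ρ : ℕ → ℝ) : ℝ := ∑' l : ℕ, if m ≤ l then (l : ℝ) ^ k * ρ l else 0

/-- An appropriate family of distributions on `ℕ`. -/
def Appropriate (ρ : ℕ → ℕ → ℝ) : Prop :=
  (∀ n, IsDist (ρ n)) ∧
  (∀ n, Summable fun l : ℕ => (l : ℝ) ^ 2 * ρ n l) ∧
  Tendsto (fun n => mu 1 (ρ n)) atTop atTop ∧
  ∀ ε : ℝ, 0 < ε → ∃ C : ℝ,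
    ∀ n, (∑' L : ℕ, if C * mu 1 (ρ n) ≤ (L : ℝ) then (L : ℝ) ^ 2 * ρ n L / mu 2 (ρ n) else 0) ≤ ε

/-- Geometric distribution `Geo(λ)(k) = λ (1-λ)^k`. -/
def geo (lam : ℝ) (k : ℕ) : ℝ := lam * (1 - lam) ^ k

/-! ### Trajectories and finitary random interlacements -/

/-- A finite trajectory in `ℤ^d`, recorded as the list of its positions. -/
abbrev Traj (d : ℕ) := List (Zd d)

/-- A point configuration: the multiplicity of each trajectory. -/
abbrev Config (d : ℕ) := Traj d → ℕ

/-- A valid trajectory: a nonempty nearest-neighbour path. -/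
def ValidTraj {d : ℕ} (η : Traj d) : Prop := η ≠ [] ∧ η.Chain' IsNN

/-- The time length `T(η)` of a trajectory. -/
def len {d : ℕ} (η : Traj d) : ℕ := η.length - 1

/-- The range of a trajectory, as a set. -/
def rangeSet {d : ℕ} (η : Traj d) : Set (Zd d) := {y | y ∈ η}

/-- The trajectory `η` visits the set `A`. -/
def hits {d : ℕ} (η : Traj d) (A : Set (Zd d)) : Prop := ∃ y ∈ η, y ∈ A

/-- Poisson probability mass `e^{-r} r^n / n!`. -/
def poissonProb (r : ℝ) (n : ℕ) : ℝ≥0∞ :=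
  ENNReal.ofReal (Real.exp (-r) * r ^ n / n.factorial)

/-- The intensity `u·π({η})` that FRI with parameters `(u,ρ)` puts on a single
trajectory `η`: trajectories of length `l` from each starting point carry mass
`u·ρ(l)/(μ₁(ρ)+1)·(2d)^{-l}` each. -/
def friIntensity (d : ℕ) (u : ℝ) (ρ : ℕ → ℝ) (η : Traj d) : ℝ :=
  if ValidTraj η then u * ρ (len η) / (mu 1 ρ + 1) * (1 / (2 * (d : ℝ))) ^ (len η) else 0

/-- `P` is the law of a Poisson point process on the countable set of trajectories
with intensity function `ι`: the multiplicities of distinct trajectories are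
independent Poisson random variables. -/
def IsPoissonPP (d : ℕ) (ι : Traj d → ℝ) (P : Measure (Config d)) : Prop :=
  IsProbabilityMeasure P ∧
    ∀ (F : Finset (Traj d)) (k : Traj d → ℕ),
      P {ω | ∀ η ∈ F, ω η = k η} = ∏ η ∈ F, poissonProb (ι η) (k η)

/-- `P` is the law of the finitary random interlacements point process `𝒳^{u,ρ}`. -/
def IsFRI (d : ℕ) (u : ℝ) (ρ : ℕ → ℝ) (P : Measure (Config d)) : Prop :=
  IsPoissonPP d (friIntensity d u ρ) P

/-- `J` is the law of an i.i.d. sequence of copies of `𝒳^{u,ρ}`. -/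
def IsFRIseq (d : ℕ) (u : ℝ) (ρ : ℕ → ℝ) (J : Measure (ℕ → Config d)) : Prop :=
  IsProbabilityMeasure J ∧
    ∀ (F : Finset (ℕ × Traj d)) (k : ℕ × Traj d → ℕ),
      J {j | ∀ p ∈ F, j p.1 p.2 = k p} = ∏ p ∈ F, poissonProb (friIntensity d u ρ p.2) (k p)

/-! ### Percolation -/

/-- The edge `{x,y}` is traversed by some trajectory of the configuration `ω`. -/
def EdgeOpen {d : ℕ} (ω : Config d) (x y : Zd d) : Prop :=
  ∃ η : Traj d, 0 < ω η ∧ ∃ i : ℕ,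
    (η[i]? = some x ∧ η[i + 1]? = some y) ∨ (η[i]? = some y ∧ η[i + 1]? = some x)

/-- The cluster of `x` in the subgraph `ℐ` induced by the configuration `ω`. -/
def Cluster {d : ℕ} (ω : Config d) (x : Zd d) : Set (Zd d) :=
  {y | Relation.ReflTransGen (EdgeOpen ω) x y}

/-- The origin lies in an infinite cluster. -/
def PercEvent (d : ℕ) : Set (Config d) := {ω | (Cluster ω 0).Infinite}

/-- The critical intensity `u_*(ρ)`, given the family `u ↦ 𝒳^{u,ρ}`. -/
def uStar (d : ℕ) (X : ℝ → Measure (Config d)) : ℝ :=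
  sInf {u : ℝ | 0 ≤ u ∧ 0 < X u (PercEvent d)}

/-- The order `u_n = μ₁(ρ)·(1 + log μ₁(ρ)·1_{d=4}) / (ε_d·μ₂(ρ))` of the
critical intensity. -/
def uN (d : ℕ) (εd : ℝ) (ρ : ℕ → ℝ) : ℝ :=
  mu 1 ρ * logFour d (mu 1 ρ) / (εd * mu 2 ρ)

/-! ### `ρ`-capacity, Green function, `κ` and `φ` -/

/-- `e_A^{(ρ)}(x) = Σ_m (μ₀^{(m)}(ρ)/(μ₁(ρ)+1))·P^x[H̃_A > m]`. -/
def equilRho {d : ℕ} (P : Zd d → Measure (ℕ → Zd d)) (ρ : ℕ → ℝ) (A : Set (Zd d))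
    (x : Zd d) : ℝ :=
  ∑' m : ℕ, (muTail 0 m ρ / (mu 1 ρ + 1)) * (P x (NoReturnUpTo A (m : ℝ))).toReal

/-- `cap^{(ρ)}(A) = Σ_{x∈A} e_A^{(ρ)}(x)`. -/
def capRho {d : ℕ} (P : Zd d → Measure (ℕ → Zd d)) (ρ : ℕ → ℝ) (A : Finset (Zd d)) : ℝ :=
  ∑ x ∈ A, equilRho P ρ (↑A) x

/-- Green's function `g(x,y) = Σ_t P^x[X_t = y]`. -/
def green {d : ℕ} (P : Zd d → Measure (ℕ → Zd d)) (x y : Zd d) : ℝ :=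
  ∑' t : ℕ, (P x {ω | ω t = y}).toReal

/-- `φ^{(ρ)}(A,B) = Σ_{x∈A} Σ_{y∈B} e_A^{(ρ)}(x) e_B^{(ρ)}(y) g(x,y)`. -/
def phiRho {d : ℕ} (P : Zd d → Measure (ℕ → Zd d)) (ρ : ℕ → ℝ) (A B : Finset (Zd d)) : ℝ :=
  ∑ x ∈ A, ∑ y ∈ B, equilRho P ρ (↑A) x * equilRho P ρ (↑B) y * green P x y

/-- `κ^{(ρ)}(A) = Σ_{x∈A} Σ_m (μ₁^{(m)}(ρ)/μ₂(ρ))·P^x[H̃_A > m]` (real-valued,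
for finite `A`). -/
def kappa {d : ℕ} (P : Zd d → Measure (ℕ → Zd d)) (ρ : ℕ → ℝ) (A : Finset (Zd d)) : ℝ :=
  ∑ x ∈ A, ∑' m : ℕ, (muTail 1 m ρ / mu 2 ρ) * (P x (NoReturnUpTo (↑A) (m : ℝ))).toReal

/-- `κ^{(ρ)}(A)` as an extended-real valued quantity, for arbitrary `A`. -/
def kappaE {d : ℕ} (P : Zd d → Measure (ℕ → Zd d)) (ρ : ℕ → ℝ) (A : Set (Zd d)) : ℝ≥0∞ :=
  ∑' x : Zd d,
    A.indicator (fun x => ∑' m : ℕ,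
      ENNReal.ofReal (muTail 1 m ρ / mu 2 ρ) * P x (NoReturnUpTo A (m : ℝ))) x

/-! ### Exploration processes -/

/-- First components: the `k`-th layer `L_k` of vertices; second components:
`∪_{i<k} L_i`.  Layer `L_{k+1}` is spanned by the trajectories of `ω` meeting `L_k`
but not `∪_{i<k} L_i`. -/
def exploreSets {d : ℕ} (ω : Config d) : ℕ → Set (Zd d) × Set (Zd d)
  | 0 => ({0}, ∅)
  | k + 1 =>
    ({y | ∃ η : Traj d, 0 < ω η ∧ hits η (exploreSets ω k).1 ∧
        ¬ hits η (exploreSets ω k).2 ∧ y ∈ η},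
      (exploreSets ω k).1 ∪ (exploreSets ω k).2)

/-- The `i`-th layer `𝓛_i` of trajectories of the exploration of the cluster of the
origin, as a sub-configuration of `ω`. -/
def exploreLayer {d : ℕ} (ω : Config d) : ℕ → Config d
  | 0 => fun _ => 0
  | k + 1 => fun η =>
      if hits η (exploreSets ω k).1 ∧ ¬ hits η (exploreSets ω k).2 then ω η else 0

/-- The vertex sets `L'_k` of the dominating exploration driven by the i.i.d.
sequence `j`. -/
def exploreSets' {d : ℕ} (j : ℕ → Config d) : ℕ → Set (Zd d)
  | 0 => {0}
  | k + 1 => {y | ∃ η : Traj d, 0 < j (k + 1) η ∧ hits η (exploreSets' j k) ∧ y ∈ η}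

/-- The trajectory layers `𝓛'_i` of the dominating exploration. -/
def exploreLayer' {d : ℕ} (j : ℕ → Config d) : ℕ → Config d
  | 0 => fun _ => 0
  | k + 1 => fun η => if hits η (exploreSets' j k) then j (k + 1) η else 0

/-- `W_k = 𝔼[κ^{(ρ)}(L'_k)]`. -/
def Wexp {d : ℕ} (P : Zd d → Measure (ℕ → Zd d)) (ρ : ℕ → ℝ)
    (J : Measure (ℕ → Config d)) (k : ℕ) : ℝ≥0∞ :=
  ∫⁻ j, kappaE P ρ (exploreSets' j k) ∂ J

/-- `V_k = 𝔼[|L'_k|]`, multiplied by `(log μ₁(ρ))⁻¹` when `d = 4`. -/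
def Vexp (d : ℕ) (ρ : ℕ → ℝ) (J : Measure (ℕ → Config d)) (k : ℕ) : ℝ≥0∞ :=
  (if d = 4 then ENNReal.ofReal (1 / Real.log (mu 1 ρ)) else 1) *
    ∫⁻ j, ENat.toENNReal (exploreSets' j k).encard ∂ J

/-! ### Two-sided finite random walk trajectories -/

/-- `μ(x,m,l)({η})`: the two-sided path `(X_{-m},…,X_l)` of a doubly infinite walk
with `X_0 = x` equals the list `η` (of length `m+l+1`, with `η[m] = x`)
with probability `(2d)^{-(m+l)}` for every admissible nearest-neighbour list. -/
def twoSidedProb (d : ℕ) (x : Zd d) (m l : ℕ) (η : Traj d) : ℝ :=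
  if η.length = m + l + 1 ∧ η.Chain' IsNN ∧ η[m]? = some x then
    (1 / (2 * (d : ℝ))) ^ (m + l) else 0

/-- The `ℓ^∞`-diameter of the range of `η` is at most `R`. -/
def DiamLE {d : ℕ} (η : Traj d) (R : ℝ) : Prop :=
  ∀ a ∈ η, ∀ b ∈ η, ∀ i, |((a i - b i : ℤ) : ℝ)| ≤ R

/-- `P^x[X[-m,-1] ∩ A = ∅]`: the probability that an `m`-step walk from `x`
avoids `A` at all positive times, written combinatorially. -/
def backAvoidProb (d : ℕ) (A : Set (Zd d)) (x : Zd d) (m : ℕ) : ℝ :=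
  ∑' w : Traj d,
    if w.length = m + 1 ∧ w.Chain' IsNN ∧ w[0]? = some x ∧
        (∀ i : ℕ, 0 < i → ∀ y, w[i]? = some y → y ∉ A) then
      (1 / (2 * (d : ℝ))) ^ m else 0

/-- `μ(x,m,l;A)({η}) = P^x[X[-m,l] = η | X[-m,-1] ∩ A = ∅]`. -/
def condTwoSidedProb (d : ℕ) (A : Set (Zd d)) (x : Zd d) (m l : ℕ) (η : Traj d) : ℝ :=
  (if ∀ i < m, ∀ y, η[i]? = some y → y ∉ A then twoSidedProb d x m l η else 0) /
    backAvoidProb d A x m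

/-- `π_A({η}) = Σ_{x∈A} Σ_{m,l} (ρ(m+l)/(μ₁(ρ)+1))·P^x[H̃_A > m]·μ(x,m,l;A)({η})`. -/
def piA (d : ℕ) (P : Zd d → Measure (ℕ → Zd d)) (ρ : ℕ → ℝ) (A : Finset (Zd d))
    (η : Traj d) : ℝ :=
  ∑ x ∈ A, ∑' m : ℕ, ∑' l : ℕ,
    ρ (m + l) / (mu 1 ρ + 1) * (P x (NoReturnUpTo (↑A) (m : ℝ))).toReal *
      condTwoSidedProb d (↑A) x m l η

/-- The sub-configuration of trajectories meeting `A`, i.e. `𝒳[A]`. -/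
def restrictConfig {d : ℕ} (A : Finset (Zd d)) (ω : Config d) : Config d :=
  fun η => if hits η (↑A) then ω η else 0

/-! ### Products and geometric laws -/

/-- The geometric measure `Geo(1/(T+1))` on `ℕ`. -/
def geoMeasure (T : ℕ) : Measure ℕ :=
  Measure.sum fun k : ℕ => (ENNReal.ofReal (geo (1 / ((T : ℝ) + 1)) k)) • Measure.dirac k

/-- `Q` is the product (independent coupling) of `μ` and `ν`. -/
def IsProdOf {α β : Type*} [MeasurableSpace α] [MeasurableSpace β]
    (Q : Measure (α × β)) (μ : Measure α) (ν : Measure β) : Prop :=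
  IsProbabilityMeasure Q ∧
    ∀ (A : Set α) (B : Set β), MeasurableSet A → MeasurableSet B → Q (A ×ˢ B) = μ A * ν B

/-! ### Coarse graining quantities -/

/-- The constant `c = 0.01`. -/
def cConst : ℝ := 0.01

/-- `R_n = ⌊√(μ₁(ρ_n))⌋`. -/
def Rn (ρ : ℕ → ℕ → ℝ) (n : ℕ) : ℕ := ⌊Real.sqrt (mu 1 (ρ n))⌋₊

/-- The mesoscopic scale `L_n`. -/
def Ln (d : ℕ) (ρ : ℕ → ℕ → ℝ) (n : ℕ) : ℝ :=
  if d = 4 then (Rn ρ n : ℝ) * (Real.log (Rn ρ n)) ^ (-cConst)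
  else (Rn ρ n : ℝ) ^ ((2 + cConst) / ((d : ℝ) - 2))

/-- The slowly growing factor `I_n`. -/
def In (d : ℕ) (ρ : ℕ → ℕ → ℝ) (n : ℕ) : ℝ :=
  if d = 4 then (Real.log (Rn ρ n)) ^ cConst else (Rn ρ n : ℝ) ^ cConst

/-- The scale `T'_n`. -/
def Tn' (d : ℕ) (ρ : ℕ → ℕ → ℝ) (n : ℕ) : ℕ :=
  if d = 4 then ⌊(Rn ρ n : ℝ) ^ (2 : ℕ) / Real.log (mu 1 (ρ n))⌋₊
  else ⌊(Rn ρ n : ℝ) ^ ((2 : ℝ) - cConst / 4)⌋₊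

/-- The scale `l_n`. -/
def lnPar (d : ℕ) (ρ : ℕ → ℕ → ℝ) (n : ℕ) : ℕ :=
  if d = 4 then ⌊(Rn ρ n : ℝ) * (Real.log (Rn ρ n)) ^ (-(2 * cConst))⌋₊
  else ⌊(Rn ρ n : ℝ) ^ ((1 : ℝ) - cConst / 4)⌋₊

/-- The scale `t_n`. -/
def tnPar (d : ℕ) (ρ : ℕ → ℕ → ℝ) (n : ℕ) : ℕ :=
  if d = 4 then ⌊(Rn ρ n : ℝ) ^ (2 : ℕ) / (Real.log (Rn ρ n)) ^ (10 : ℕ)⌋₊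
  else ⌊(Rn ρ n : ℝ) ^ ((2 : ℝ) - cConst)⌋₊

/-- `y` is within `ℓ^∞`-distance `r` of `z`. -/
def InBall {d : ℕ} (y z : Zd d) (r : ℝ) : Prop := ∀ i, |((y i - z i : ℤ) : ℝ)| ≤ r

/-- The `ℓ^∞` `r`-neighbourhood `B(A,r)`. -/
def nbhd {d : ℕ} (A : Set (Zd d)) (r : ℝ) : Set (Zd d) := {y | ∃ z ∈ A, InBall y z r}

/-- The sub-path `η[a, b]` of a trajectory. -/
def segment {d : ℕ} (η : Traj d) (a b : ℕ) : Traj d := (η.drop a).take (b - a + 1)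

/-- `η` is a typical trajectory (the event `𝒯_n = ℰ₁ ∩ ℰ₂ ∩ ℰ₃ ∩ ℰ₄`). -/
def Typical (d : ℕ) (P : Zd d → Measure (ℕ → Zd d)) (εd : ℝ) (ρ : ℕ → ℕ → ℝ)
    (kk KK M θ1 : ℝ) (n : ℕ) (η : Traj d) : Prop :=
  ValidTraj η ∧
  -- ℰ₁
  (kk * (Rn ρ n : ℝ) ^ 2 ≤ (len η : ℝ) ∧ (len η : ℝ) ≤ KK * (Rn ρ n : ℝ) ^ 2 ∧
    ∀ y ∈ η, InBall y η.headI (M * (Rn ρ n : ℝ))) ∧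
  -- ℰ₂
  (if d = 4 then
    (1 - θ1 ^ 2) * (Real.pi ^ 2 / 8) * (len η : ℝ) / Real.log (mu 1 (ρ n)) <
        capacity P η.toFinset ∧
      capTrunc P η.toFinset ((Rn ρ n : ℝ) ^ 2) <
        (1 + θ1 ^ 2) * (Real.pi ^ 2 / 8) * (len η : ℝ) / Real.log (mu 1 (ρ n))
  else
    (1 - θ1 ^ 2) * εd * (len η : ℝ) < capacity P η.toFinset ∧
      capacity P η.toFinset < (1 + θ1 ^ 2) * εd * (len η : ℝ)) ∧
  -- ℰ₃
  ((Set.ncard (nbhd (rangeSet η) (Ln d ρ n)) : ℝ) <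
    (Rn ρ n : ℝ) ^ 2 * (Ln d ρ n) ^ (d - 2) * (In d ρ n) ^ ((1 : ℝ) / 3)) ∧
  -- ℰ₄
  (∀ j : ℕ, j * Tn' d ρ n ≤ len η →
    if d = 4 then
      capacity P (segment η (j * Tn' d ρ n) (min ((j + 1) * Tn' d ρ n) (len η))).toFinset ≤
          (1 + θ1 ^ 2) * (Real.pi ^ 2 / 8) * (Tn' d ρ n : ℝ) / Real.log (mu 1 (ρ n)) ∧
        ∀ a ∈ segment η (j * Tn' d ρ n) (min ((j + 1) * Tn' d ρ n) (len η)),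
          ∀ b ∈ segment η (j * Tn' d ρ n) (min ((j + 1) * Tn' d ρ n) (len η)),
            ∀ i, |((a i - b i : ℤ) : ℝ)| <
              (1 / 2) * Real.sqrt (len η : ℝ) * (Real.log (mu 1 (ρ n))) ^ (-cConst)
    else
      capacity P (segment η (j * Tn' d ρ n) (min ((j + 1) * Tn' d ρ n) (len η))).toFinset ≤
        (1 + θ1 ^ 2) * εd * (Tn' d ρ n : ℝ))

/-- `x` belongs to the `*`-proper part `η̂` of the trajectory `η`. -/
def ProperStar (d : ℕ) (P : Zd d → Measure (ℕ → Zd d)) (ρ : ℕ → ℕ → ℝ)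
    (θ1 θ2 : ℝ) (n : ℕ) (η : Traj d) (x : Zd d) : Prop :=
  x ∈ rangeSet η ∧
    (if d = 4 then
      θ2 / Real.log (mu 1 (ρ n)) ≤ equil P (rangeSet η) x ∧
        (P x (NoReturnUpTo (rangeSet η)
            ((Rn ρ n : ℝ) ^ 2 / (Real.log (Rn ρ n)) ^ (10 : ℕ)))).toReal ≤
          (1 + θ1) * equil P (rangeSet η) x
    else θ2 ≤ equil P (rangeSet η) x)

/-! ### Finite words and averages -/

/-- A step of the walk. -/
abbrev Step (d : ℕ) := Fin d × Bool

/-- The lattice vector of a step. -/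
def sv {d : ℕ} (s : Step d) : Zd d := Pi.single s.1 (if s.2 then 1 else -1)

/-- The displacement of a word. -/
def SS {d : ℕ} (w : List (Step d)) : Zd d := (w.map sv).sum

/-- Average over a uniformly chosen step. -/
def avg {d : ℕ} (f : Step d → ℝ) : ℝ := (∑ s, f s) / (2 * d)

/-- Average over uniformly chosen words of length `n`. -/
def EL {d : ℕ} : ℕ → (List (Step d) → ℝ) → ℝ
  | 0, f => f []
  | n + 1, f => avg (fun s => EL n (fun w => f (s :: w)))

section words
variable {d : ℕ}

@[simp] lemma SS_nil : SS ([] : List (Step d)) = 0 := rfl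
@[simp] lemma SS_cons (s : Step d) (w) : SS (s :: w) = sv s + SS w := by simp [SS]
@[simp] lemma SS_append (u w : List (Step d)) : SS (u ++ w) = SS u + SS w := by simp [SS]

lemma avg_mono {f g : Step d → ℝ} (h : ∀ s, f s ≤ g s) : avg f ≤ avg g := by
  unfold avg
  gcongr
  exact h _

lemma avg_const (hd : 0 < d) (c : ℝ) : avg (fun _ : Step d => c) = c := by
  have : (d : ℝ) ≠ 0 := by positivity
  simp [avg]
  field_simp

lemma avg_add (f g : Step d → ℝ) : avg (fun s => f s + g s) = avg f + avg g := by
  simp [avg, Finset.sum_add_distrib, add_div]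

lemma avg_mul_left (c : ℝ) (f : Step d → ℝ) : avg (fun s => c * f s) = c * avg f := by
  simp [avg, ← Finset.mul_sum, mul_div_assoc]

lemma avg_sum {ι : Type*} (t : Finset ι) (f : ι → Step d → ℝ) :
    avg (fun s => ∑ i ∈ t, f i s) = ∑ i ∈ t, avg (f i) := by
  simp only [avg]
  rw [Finset.sum_comm, Finset.sum_div]

lemma EL_succ (n : ℕ) (f : List (Step d) → ℝ) :
    EL (n + 1) f = avg (fun s => EL n (fun w => f (s :: w))) := rfl

lemma EL_mono {n : ℕ} {f g : List (Step d) → ℝ} (h : ∀ w, w.length = n → f w ≤ g w) :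
    EL n f ≤ EL n g := by
  induction n generalizing f g with
  | zero => exact h [] rfl
  | succ n ih =>
    exact avg_mono fun s => ih fun w hw => h _ (by simp [hw])

lemma EL_congr {n : ℕ} {f g : List (Step d) → ℝ} (h : ∀ w, w.length = n → f w = g w) :
    EL n f = EL n g :=
  le_antisymm (EL_mono fun w hw => (h w hw).le) (EL_mono fun w hw => (h w hw).ge)

lemma EL_const (hd : 0 < d) (n : ℕ) (c : ℝ) : EL n (fun _ : List (Step d) => c) = c := by
  induction n with
  | zero => rfl
  | succ n ih => simp only [EL_succ, ih, avg_const hd]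

lemma EL_add (n : ℕ) (f g : List (Step d) → ℝ) :
    EL n (fun w => f w + g w) = EL n f + EL n g := by
  induction n generalizing f g with
  | zero => rfl
  | succ n ih => simp only [EL_succ, ih, avg_add]

lemma EL_mul_left (n : ℕ) (c : ℝ) (f : List (Step d) → ℝ) :
    EL n (fun w => c * f w) = c * EL n f := by
  induction n generalizing f with
  | zero => rfl
  | succ n ih => simp only [EL_succ, ih, avg_mul_left]

lemma EL_mul_right (n : ℕ) (c : ℝ) (f : List (Step d) → ℝ) :
    EL n (fun w => f w * c) = EL n f * c := by
  simp only [mul_comm _ c, EL_mul_left]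

lemma EL_sum {ι : Type*} (n : ℕ) (t : Finset ι) (f : ι → List (Step d) → ℝ) :
    EL n (fun w => ∑ i ∈ t, f i w) = ∑ i ∈ t, EL n (f i) := by
  induction n generalizing f with
  | zero => rfl
  | succ n ih => simp only [EL_succ, ih, avg_sum]

lemma EL_nonneg {n : ℕ} {f : List (Step d) → ℝ} (h : ∀ w, w.length = n → 0 ≤ f w) :
    0 ≤ EL n f := by
  have := EL_mono (f := fun _ : List (Step d) => (0 : ℝ) * 0) (g := f) (n := n) (by simpa using h)
  rw [EL_mul_left] at this
  simpa using this

lemma EL_append (m n : ℕ) (f : List (Step d) → ℝ) :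
    EL (m + n) f = EL m (fun u => EL n (fun v => f (u ++ v))) := by
  induction m generalizing f with
  | zero => simp [EL]
  | succ m ih =>
    rw [show m + 1 + n = (m + n) + 1 by ring]
    simp only [EL_succ, ih, List.cons_append]

lemma EL_avg (n : ℕ) (f : Step d → List (Step d) → ℝ) :
    EL n (fun w => avg (fun s => f s w)) = avg (fun s => EL n (f s)) := by
  simp only [avg, div_eq_mul_inv, EL_mul_right, EL_sum]

lemma EL_comm (m n : ℕ) (f : List (Step d) → List (Step d) → ℝ) :
    EL m (fun u => EL n (fun v => f u v)) = EL n (fun v => EL m (fun u => f u v)) := by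
  induction m generalizing f with
  | zero => rfl
  | succ m ih => simp only [EL_succ, ih, EL_avg]

lemma EL_hasSum (n : ℕ) (f : ℕ → List (Step d) → ℝ) (F : List (Step d) → ℝ)
    (h : ∀ w, HasSum (fun k => f k w) (F w)) : HasSum (fun k => EL n (f k)) (EL n F) := by
  induction n generalizing f F with
  | zero => exact h []
  | succ n ih =>
    simp only [EL_succ, avg]
    exact (hasSum_sum fun s _ => ih _ _ fun w => h _).div_const _

lemma EL_take {a n : ℕ} (hd : 0 < d) (h : a ≤ n) (f : List (Step d) → ℝ) :
    EL n (fun w => f (w.take a)) = EL a f := by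
  obtain ⟨b, rfl⟩ := Nat.exists_eq_add_of_le h
  rw [EL_append]
  refine EL_congr fun u hu => ?_
  have : ∀ v : List (Step d), (u ++ v).take a = u := fun v => by
    rw [← hu, List.take_left]
  simp only [this, EL_const hd]

/-- The word form of `EL`. -/
lemma EL_eq_sum (n : ℕ) (f : List (Step d) → ℝ) :
    EL n f = ((2 * d : ℝ)⁻¹) ^ n * ∑ w : Fin n → Step d, f (List.ofFn w) := by
  induction n generalizing f with
  | zero => simp [EL]
  | succ n ih =>
    simp only [EL_succ, ih, avg_mul_left]
    have h : ∑ w : Fin (n + 1) → Step d, f (List.ofFn w) =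
        ∑ s : Step d, ∑ w : Fin n → Step d, f (s :: List.ofFn w) := by
      rw [← (Fin.consEquiv (fun _ : Fin (n + 1) => Step d)).sum_comp,
        Fintype.sum_prod_type (f := fun p : Step d × (Fin n → Step d) => _)]
      refine Finset.sum_congr rfl fun s _ => Finset.sum_congr rfl fun w _ => ?_
      simp [Fin.consEquiv, List.ofFn_succ]
    rw [h, avg, pow_succ]
    ring

/-- The transition probabilities. -/
def pp (n : ℕ) (x : Zd d) : ℝ := EL n (fun w => if SS w = x then 1 else 0)

lemma pp_zero (x : Zd d) : pp 0 x = if x = 0 then 1 else 0 := by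
  simp [pp, EL, eq_comm]

lemma pp_succ (n : ℕ) (x : Zd d) : pp (n + 1) x = avg (fun s => pp n (x - sv s)) := by
  simp only [pp, EL_succ, SS_cons]
  congr 1; ext s; congr 1; ext w
  congr 1
  rw [eq_sub_iff_add_eq']

lemma pp_nonneg (n : ℕ) (x : Zd d) : 0 ≤ pp n x :=
  EL_nonneg fun w _ => by positivity

lemma pp_neg (n : ℕ) (x : Zd d) : pp n (-x) = pp n x := by
  induction n generalizing x with
  | zero => simp [pp_zero]
  | succ n ih =>
    simp only [pp_succ, avg]
    congr 1
    refine Fintype.sum_equiv (Equiv.prodCongr (Equiv.refl _) Equiv.boolNot) _ _ fun s => ?_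
    rw [← ih]
    congr 1
    obtain ⟨i, b⟩ := s
    cases b <;> simp [sv, Pi.single_neg] <;> abel

lemma EL_pp_sub (m n : ℕ) (x : Zd d) : EL m (fun u => pp n (x - SS u)) = pp (m + n) x := by
  rw [pp, EL_append]
  simp only [pp, SS_append, eq_sub_iff_add_eq']

lemma EL_pp_add (m n : ℕ) (x : Zd d) : EL m (fun u => pp n (x + SS u)) = pp (m + n) x := by
  rw [← pp_neg, ← EL_pp_sub]
  congr 1; ext u
  rw [← pp_neg]; congr 1; abel

end words

/-! ### Fourier representation and heat kernel bounds -/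

/-- Lebesgue measure on one period. -/
def nuT : Measure ℝ := volume.restrict (Set.Ioc (-Real.pi) Real.pi)

instance : IsFiniteMeasure nuT := by unfold nuT; infer_instance

/-- Lebesgue measure on the torus. -/
def muT (d : ℕ) : Measure (Fin d → ℝ) := Measure.pi (fun _ => nuT)

instance (d : ℕ) : IsFiniteMeasure (muT d) := by unfold muT; infer_instance

/-- Characteristic function of a step. -/
def phiT {d : ℕ} (θ : Fin d → ℝ) : ℝ := (∑ i, Real.cos (θ i)) / d

/-- Fourier characters. -/
def ee {d : ℕ} (x : Zd d) (θ : Fin d → ℝ) : ℂ :=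
  ∏ i, Complex.exp ((x i : ℂ) * (θ i : ℂ) * Complex.I)

/-- Fourier coefficients of the powers of the characteristic function. -/
def JJ {d : ℕ} (n : ℕ) (x : Zd d) : ℂ := ∫ θ, ((phiT θ : ℝ) : ℂ) ^ n * ee x θ ∂(muT d)

/-- `(1+n)^{-1/2}`. -/
def xx (n : ℕ) : ℝ := 1 / Real.sqrt (1 + n)

section fourier
variable {d : ℕ}

lemma ee_add (x y : Zd d) (θ) : ee (x + y) θ = ee x θ * ee y θ := by
  simp only [ee, ← Finset.prod_mul_distrib, ← Complex.exp_add]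
  congr 1; ext i; congr 1; simp; ring

lemma ee_single (i : Fin d) (c : ℤ) (θ) :
    ee (Pi.single i c) θ = Complex.exp ((c : ℂ) * (θ i : ℂ) * Complex.I) := by
  rw [ee, Finset.prod_eq_single i]
  · simp
  · intro j _ hj; simp [Pi.single_eq_of_ne hj]
  · simp

lemma norm_ee (x : Zd d) (θ) : ‖ee x θ‖ = 1 := by
  rw [ee, norm_prod]
  refine Finset.prod_eq_one fun i _ => ?_
  have : ((x i : ℂ) * (θ i : ℂ) * Complex.I) = (((x i : ℝ) * θ i : ℝ) : ℂ) * Complex.I := by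
    push_cast; ring
  rw [this, Complex.norm_exp_ofReal_mul_I]

lemma ee_step (hd : 0 < d) (x : Zd d) (θ) :
    (∑ s : Step d, ee (x - sv s) θ) / (2 * d) = (phiT θ : ℂ) * ee x θ := by
  have h : ∀ s : Step d, ee (x - sv s) θ = ee x θ *
      Complex.exp (((if s.2 then -1 else 1 : ℤ) : ℂ) * (θ s.1 : ℂ) * Complex.I) := by
    intro s
    rw [sub_eq_add_neg, ee_add, sv, ← Pi.single_neg, ee_single]
    congr 4
    split_ifs <;> simp
  simp only [h, ← Finset.mul_sum]
  rw [Fintype.sum_prod_type]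
  simp only [Fintype.sum_bool, phiT]
  have h2 : ∀ i, (Complex.exp (((if true then -1 else 1 : ℤ) : ℂ) * (θ i : ℂ) * Complex.I) +
      Complex.exp (((if false then -1 else 1 : ℤ) : ℂ) * (θ i : ℂ) * Complex.I)) =
      2 * Complex.cos (θ i) := by
    intro i
    rw [Complex.cos]
    simp
    ring
  have h3 : (d : ℂ) ≠ 0 := by exact_mod_cast hd.ne'
  simp only [Bool.false_eq_true, if_true, if_false] at h2 ⊢
  simp only [h2, ← Finset.mul_sum]
  push_cast
  field_simp

lemma abs_phiT_le (θ : Fin d → ℝ) : |phiT θ| ≤ 1 := by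
  rcases Nat.eq_zero_or_pos d with rfl | hd
  · simp [phiT]
  · have hd' : (0 : ℝ) < d := by exact_mod_cast hd
    rw [phiT, abs_div, abs_of_pos hd', div_le_one hd']
    calc |∑ i, Real.cos (θ i)| ≤ ∑ i, |Real.cos (θ i)| := Finset.abs_sum_le_sum_abs _ _
      _ ≤ ∑ _i : Fin d, (1 : ℝ) := Finset.sum_le_sum fun i _ => Real.abs_cos_le_one _
      _ = d := by simp

lemma continuous_phiT : Continuous (phiT : (Fin d → ℝ) → ℝ) := by
  unfold phiT; fun_prop

lemma continuous_ee (x : Zd d) : Continuous (ee x) := by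
  unfold ee; fun_prop

lemma JJ_integrable (n : ℕ) (x : Zd d) :
    Integrable (fun θ => ((phiT θ : ℝ) : ℂ) ^ n * ee x θ) (muT d) := by
  refine Integrable.of_bound (C := 1) ?_ ?_
  · have := continuous_phiT (d := d)
    have := continuous_ee x
    exact Continuous.aestronglyMeasurable (by fun_prop)
  · refine Eventually.of_forall fun θ => ?_
    rw [norm_mul, norm_ee, mul_one, norm_pow, Complex.norm_real, Real.norm_eq_abs]
    exact pow_le_one₀ (abs_nonneg _) (abs_phiT_le θ)

lemma JJ_succ (hd : 0 < d) (n : ℕ) (x : Zd d) :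
    JJ (n + 1) x = (∑ s : Step d, JJ n (x - sv s)) / (2 * d) := by
  simp only [JJ]
  rw [← integral_finsetSum _ (fun s _ => JJ_integrable n _), ← integral_div]
  congr 1; ext θ
  rw [← Finset.mul_sum, mul_div_assoc, ee_step hd, pow_succ]; ring

lemma int_nuT_exp (k : ℤ) : ∫ t, Complex.exp ((k : ℂ) * (t : ℂ) * Complex.I) ∂nuT =
    if k = 0 then (2 * Real.pi : ℂ) else 0 := by
  have hpi : -Real.pi ≤ Real.pi := by linarith [Real.pi_pos]
  rw [nuT, ← intervalIntegral.integral_of_le hpi]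
  split_ifs with h
  · subst h; simp; ring
  · have hc : (k : ℂ) * Complex.I ≠ 0 := by
      simp [h, Complex.I_ne_zero]
    have := integral_exp_mul_complex (a := -Real.pi) (b := Real.pi) hc
    have e : ∀ t : ℝ, (k : ℂ) * (t : ℂ) * Complex.I = (k : ℂ) * Complex.I * t := fun t => by ring
    simp only [e, this]
    have e1 : Complex.exp ((k : ℂ) * Complex.I * (Real.pi : ℝ)) =
        Complex.exp ((k : ℂ) * Complex.I * ((-Real.pi : ℝ) : ℂ)) := by
      rw [Complex.exp_eq_exp_iff_exists_int]
      exact ⟨k, by push_cast; ring⟩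
    rw [e1, sub_self, zero_div]

lemma JJ_zero (x : Zd d) : JJ 0 x = (2 * Real.pi : ℂ) ^ d * (if x = 0 then 1 else 0) := by
  simp only [JJ, pow_zero, one_mul, ee, muT]
  rw [integral_fintype_prod_eq_prod
    (f := fun i (t : ℝ) => Complex.exp ((x i : ℂ) * (t : ℂ) * Complex.I))]
  simp only [int_nuT_exp]
  split_ifs with h
  · subst h; simp
  · obtain ⟨i, hi⟩ := Function.ne_iff.1 h
    rw [mul_zero]
    refine Finset.prod_eq_zero (Finset.mem_univ i) ?_
    rw [if_neg]; simpa using hi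

lemma JJ_eq (hd : 0 < d) (n : ℕ) (x : Zd d) :
    JJ n x = (2 * Real.pi : ℂ) ^ d * (pp n x : ℂ) := by
  induction n generalizing x with
  | zero => rw [JJ_zero, pp_zero]; split_ifs <;> simp
  | succ n ih =>
    rw [JJ_succ hd, pp_succ, avg]
    simp only [ih]
    push_cast
    rw [← Finset.mul_sum, mul_div_assoc]

lemma phi_pow_integrable (n : ℕ) : Integrable (fun θ => (phiT θ) ^ n) (muT d) := by
  refine Integrable.of_bound (C := 1) ?_ ?_
  · have := continuous_phiT (d := d)
    exact Continuous.aestronglyMeasurable (by fun_prop)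
  · refine Eventually.of_forall fun θ => ?_
    rw [norm_pow, Real.norm_eq_abs]
    exact pow_le_one₀ (abs_nonneg _) (abs_phiT_le θ)

lemma ee_zero (θ : Fin d → ℝ) : ee 0 θ = 1 := by simp [ee]

lemma pp_zero_eq (hd : 0 < d) (n : ℕ) :
    (2 * Real.pi) ^ d * pp n (0 : Zd d) = ∫ θ, (phiT θ) ^ n ∂(muT d) := by
  have h := JJ_eq hd n (0 : Zd d)
  simp only [JJ, ee_zero, mul_one] at h
  have e : (fun θ : Fin d → ℝ => ((phiT θ : ℝ) : ℂ) ^ n) = fun θ => (((phiT θ) ^ n : ℝ) : ℂ) := by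
    ext; push_cast; rfl
  rw [e, integral_complex_ofReal] at h
  exact_mod_cast h.symm

lemma pp_even_le (hd : 0 < d) (n : ℕ) (x : Zd d) : pp (2 * n) x ≤ pp (2 * n) (0 : Zd d) := by
  have h0 : 0 < (2 * Real.pi) ^ d := by positivity
  refine le_of_mul_le_mul_left ?_ h0
  rw [pp_zero_eq hd]
  have h := JJ_eq hd (2 * n) x
  have h1 : (2 * Real.pi) ^ d * pp (2 * n) x = ‖JJ (2 * n) x‖ := by
    rw [h]
    have : ((2 * Real.pi : ℂ) ^ d * (pp (2 * n) x : ℂ)) =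
      (((2 * Real.pi) ^ d * pp (2 * n) x : ℝ) : ℂ) := by push_cast; rfl
    rw [this, Complex.norm_real, Real.norm_eq_abs, abs_of_nonneg]
    have := pp_nonneg (2 * n) x
    positivity
  rw [h1, JJ]
  refine (norm_integral_le_integral_norm _).trans (le_of_eq ?_)
  congr 1; ext θ
  rw [norm_mul, norm_ee, mul_one, norm_pow, Complex.norm_real, Real.norm_eq_abs]
  rw [pow_mul, sq_abs, ← pow_mul]

lemma sin_int (a : ℝ) (ha : 0 < a) :
    ∫ t, Real.exp (-a * Real.sin t ^ 2) ∂nuT ≤ 6 / Real.sqrt a := by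
  have hpi := Real.pi_pos
  rw [nuT, ← intervalIntegral.integral_of_le (by linarith)]
  set f : ℝ → ℝ := fun t => Real.exp (-a * Real.sin t ^ 2) with hf
  have hc : Continuous f := by rw [hf]; fun_prop
  have hper : Function.Periodic f Real.pi := by
    intro t; simp [hf, Real.sin_add_pi]
  have h1 : ∫ t in (-Real.pi)..Real.pi, f t = 2 * ∫ t in (-(Real.pi/2))..(Real.pi/2), f t := by
    rw [← intervalIntegral.integral_add_adjacent_intervals (b := 0)
      (hc.intervalIntegrable _ _) (hc.intervalIntegrable _ _)]
    have e1 := hper.intervalIntegral_add_eq (-Real.pi) (-(Real.pi/2))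
    have e2 := hper.intervalIntegral_add_eq 0 (-(Real.pi/2))
    rw [show -Real.pi + Real.pi = 0 by ring,
      show -(Real.pi/2) + Real.pi = Real.pi/2 by ring] at e1
    rw [show 0 + Real.pi = Real.pi by ring,
      show -(Real.pi/2) + Real.pi = Real.pi/2 by ring] at e2
    rw [e1, e2]; ring
  have hb : 0 < a * (4 / Real.pi ^ 2) := by positivity
  have h2 : ∫ t in (-(Real.pi/2))..(Real.pi/2), f t ≤
      ∫ t : ℝ, Real.exp (-(a * (4 / Real.pi ^ 2)) * t ^ 2) := by
    rw [intervalIntegral.integral_of_le (by linarith)]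
    have hg := integrable_exp_neg_mul_sq hb
    calc ∫ t in Set.Ioc (-(Real.pi/2)) (Real.pi/2), f t
        ≤ ∫ t in Set.Ioc (-(Real.pi/2)) (Real.pi/2),
            Real.exp (-(a * (4 / Real.pi ^ 2)) * t ^ 2) := by
          refine setIntegral_mono_on (hc.integrableOn_Ioc) hg.integrableOn measurableSet_Ioc ?_
          intro t ht
          refine Real.exp_le_exp.2 ?_
          have := Real.mul_abs_le_abs_sin (x := t) (abs_le.2 ⟨ht.1.le, ht.2⟩)
          have h4 : (2 / Real.pi * |t|) ^ 2 ≤ |Real.sin t| ^ 2 :=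
            pow_le_pow_left₀ (by positivity) this 2
          rw [mul_pow, sq_abs, sq_abs, div_pow] at h4
          nlinarith
      _ ≤ _ := setIntegral_le_integral hg (Eventually.of_forall fun t => (Real.exp_pos _).le)
  rw [integral_gaussian] at h2
  have h3 : Real.sqrt (Real.pi / (a * (4 / Real.pi ^ 2))) ≤ 3 / Real.sqrt a := by
    rw [Real.sqrt_le_left (by positivity), div_pow, Real.sq_sqrt ha.le]
    rw [div_le_div_iff₀ hb ha]
    have : Real.pi ^ 3 ≤ 36 := by
      have := Real.pi_lt_d2
      calc Real.pi ^ 3 ≤ 3.15 ^ 3 := by gcongr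
        _ ≤ 36 := by norm_num
    have e : 3 ^ 2 * (a * (4 / Real.pi ^ 2)) = 36 * a / Real.pi ^ 2 := by ring
    rw [e, le_div_iff₀ (by positivity)]
    nlinarith
  rw [h1]
  calc 2 * _ ≤ 2 * (3 / Real.sqrt a) := by linarith
    _ = _ := by ring

lemma phi_pow_le (hd : 0 < d) (m : ℕ) (θ : Fin d → ℝ) :
    (phiT θ) ^ (2 * m) ≤ ∏ i, Real.exp (-(m / d : ℝ) * Real.sin (θ i) ^ 2) := by
  have hd' : (0 : ℝ) < d := by exact_mod_cast hd
  have h1 : (phiT θ) ^ 2 ≤ Real.exp (-(1 / d : ℝ) * ∑ i, Real.sin (θ i) ^ 2) := by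
    have h2 : (∑ i, Real.cos (θ i)) ^ 2 ≤ d * ∑ i, Real.cos (θ i) ^ 2 := by
      have := sq_sum_le_card_mul_sum_sq (s := (Finset.univ : Finset (Fin d)))
        (f := fun i => Real.cos (θ i))
      simpa using this
    have h3 : ∑ i, Real.cos (θ i) ^ 2 = d - ∑ i, Real.sin (θ i) ^ 2 := by
      rw [eq_sub_iff_add_eq, ← Finset.sum_add_distrib]
      simp
    calc (phiT θ) ^ 2 = (∑ i, Real.cos (θ i)) ^ 2 / d ^ 2 := by rw [phiT, div_pow]
      _ ≤ (d * (d - ∑ i, Real.sin (θ i) ^ 2)) / d ^ 2 := by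
        rw [← h3]; gcongr
      _ = -(1 / d : ℝ) * (∑ i, Real.sin (θ i) ^ 2) + 1 := by field_simp; ring
      _ ≤ _ := Real.add_one_le_exp _
  rw [pow_mul, ← Real.exp_sum, ← Finset.mul_sum]
  calc ((phiT θ) ^ 2) ^ m ≤ (Real.exp (-(1 / d : ℝ) * ∑ i, Real.sin (θ i) ^ 2)) ^ m :=
        pow_le_pow_left₀ (sq_nonneg _) h1 m
    _ = _ := by rw [← Real.exp_nat_mul]; congr 1; ring

lemma pp_le_one (hd : 0 < d) (n : ℕ) (x : Zd d) : pp n x ≤ 1 := by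
  rw [← EL_const hd n 1]
  exact EL_mono fun w _ => by split_ifs <;> norm_num

lemma pp_even_bound (hd : 0 < d) (m : ℕ) (hm : 0 < m) :
    pp (2 * m) (0 : Zd d) ≤ (6 / Real.sqrt (m / d)) ^ d := by
  have hd' : (0 : ℝ) < d := by exact_mod_cast hd
  have hm' : (0 : ℝ) < m := by exact_mod_cast hm
  have h := pp_zero_eq hd (2 * m)
  have h1 : 1 ≤ (2 * Real.pi) ^ d := one_le_pow₀ (by linarith [Real.pi_gt_three])
  have h2 : pp (2 * m) (0 : Zd d) ≤ (2 * Real.pi) ^ d * pp (2 * m) (0 : Zd d) :=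
    le_mul_of_one_le_left (pp_nonneg _ _) h1
  refine h2.trans ?_
  rw [h]
  have hInt : Integrable (fun θ : Fin d → ℝ => ∏ i, Real.exp (-(m / d : ℝ) * Real.sin (θ i) ^ 2))
      (muT d) := by
    refine Integrable.of_bound (C := 1) ?_ ?_
    · exact Continuous.aestronglyMeasurable (by fun_prop)
    · refine Eventually.of_forall fun θ => ?_
      rw [Real.norm_eq_abs, abs_of_nonneg (Finset.prod_nonneg fun i _ => (Real.exp_pos _).le)]
      refine Finset.prod_le_one (fun i _ => (Real.exp_pos _).le) fun i _ => ?_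
      rw [Real.exp_le_one_iff]
      have : 0 ≤ (m / d : ℝ) * Real.sin (θ i) ^ 2 := by positivity
      linarith
  refine (integral_mono (phi_pow_integrable _) hInt (phi_pow_le hd m)).trans ?_
  rw [muT, integral_fintype_prod_eq_prod
    (f := fun (_ : Fin d) t => Real.exp (-(m / d : ℝ) * Real.sin t ^ 2)), Finset.prod_const]
  simp only [Finset.card_univ, Fintype.card_fin]
  refine pow_le_pow_left₀ (integral_nonneg fun t => (Real.exp_pos _).le) ?_ d
  exact sin_int _ (by positivity)

lemma xx_pos (n : ℕ) : 0 < xx n := by unfold xx; positivity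

lemma xx_le_one (n : ℕ) : xx n ≤ 1 := by
  unfold xx
  rw [div_le_one (by positivity), Real.one_le_sqrt]
  linarith [Nat.cast_nonneg (α := ℝ) n]

lemma xx_sq (n : ℕ) : xx n ^ 2 = 1 / (1 + n) := by
  rw [xx, div_pow, Real.sq_sqrt (by positivity), one_pow]

lemma pp_upper (hd : 0 < d) : ∃ C : ℝ, 0 < C ∧ ∀ n (x : Zd d), pp n x ≤ C * xx n ^ d := by
  have hd' : (0 : ℝ) < d := by exact_mod_cast hd
  refine ⟨(12 * Real.sqrt d) ^ d, by positivity, fun n x => ?_⟩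
  have hsd : 1 ≤ Real.sqrt d := by
    rw [Real.one_le_sqrt]; exact_mod_cast hd
  rw [← mul_pow]
  rcases Nat.lt_or_ge n 2 with hn | hn
  · refine (pp_le_one hd n x).trans (one_le_pow₀ ?_)
    have : (1/2 : ℝ) ≤ xx n := by
      rw [xx]
      gcongr
      rw [Real.sqrt_le_left (by norm_num)]
      have : (n : ℝ) ≤ 1 := by exact_mod_cast Nat.lt_succ_iff.1 hn
      linarith
    nlinarith
  · have key : ∀ m, 0 < m → n ≤ 2 * m + 1 → (6 / Real.sqrt (m / d)) ^ d ≤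
        (12 * Real.sqrt d * xx n) ^ d := by
      intro m hm hnm
      have hm' : (0 : ℝ) < m := by exact_mod_cast hm
      refine pow_le_pow_left₀ (by positivity) ?_ d
      have h4 : (1 + n : ℝ) ≤ 4 * m := by
        have : 1 + n ≤ 4 * m := by omega
        exact_mod_cast this
      have h5 : Real.sqrt (1 + n) ≤ 2 * Real.sqrt m := by
        rw [Real.sqrt_le_left (by positivity), mul_pow, Real.sq_sqrt hm'.le]; linarith
      rw [Real.sqrt_div hm'.le, xx]
      have hs : 0 < Real.sqrt m := Real.sqrt_pos.2 hm'
      have hs2 : 0 < Real.sqrt (1 + n) := Real.sqrt_pos.2 (by positivity)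
      rw [div_div_eq_mul_div, mul_one_div, div_le_div_iff₀ hs hs2]
      nlinarith
    have even : ∀ m, 0 < m → ∀ y : Zd d, pp (2 * m) y ≤ (6 / Real.sqrt (m / d)) ^ d :=
      fun m hm y => (pp_even_le hd m y).trans (pp_even_bound hd m hm)
    rcases Nat.even_or_odd' n with ⟨m, rfl | rfl⟩
    · exact (even m (by omega) x).trans (key m (by omega) (by omega))
    · refine le_trans ?_ (key m (by omega) (by omega))
      rw [pp_succ, ← avg_const hd ((6 / Real.sqrt (m / d)) ^ d)]
      exact avg_mono fun s => even m (by omega) _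

lemma pp_lower (hd : 0 < d) : ∃ c : ℝ, 0 < c ∧ ∀ n, c * xx n ^ d ≤ pp (2 * n) (0 : Zd d) := by
  have hd' : (0 : ℝ) < d := by exact_mod_cast hd
  have hpi := Real.pi_gt_three
  refine ⟨1 / 2 * (1 / (2 * Real.pi)) ^ d, by positivity, fun n => ?_⟩
  have h0 : 0 < (2 * Real.pi) ^ d := by positivity
  refine le_of_mul_le_mul_left ?_ h0
  rw [pp_zero_eq hd]
  set h : ℝ := xx n / 2 with hh
  have hpos : 0 < h := by have := xx_pos n; positivity
  have hle : h ≤ 1 := by have := xx_le_one n; linarith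
  have hsq : h ^ 2 * (n + 1) ≤ 1 / 2 := by
    rw [hh, div_pow, xx_sq]; field_simp; linarith
  have hI : ∫ t, (Set.Icc (-h) h).indicator (fun _ => (1:ℝ)) t ∂nuT = 2 * h := by
    rw [integral_indicator measurableSet_Icc, nuT, Measure.restrict_restrict measurableSet_Icc,
      Set.inter_eq_left.2]
    · simp [Measure.real, Real.volume_Icc]; 
      rw [ENNReal.toReal_ofReal (by linarith)]; ring
    · intro t ht; exact ⟨by linarith [ht.1], by linarith [ht.2]⟩
  have hP : ∫ θ, ∏ i, (Set.Icc (-h) h).indicator (fun _ => (1:ℝ)) (θ i) ∂(muT d) = (2 * h) ^ d := by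
    rw [muT, integral_fintype_prod_eq_prod
      (f := fun (_ : Fin d) t => (Set.Icc (-h) h).indicator (fun _ => (1:ℝ)) t), Finset.prod_const]
    simp only [Finset.card_univ, Fintype.card_fin, hI]
  have e : (2 * Real.pi) ^ d * (1 / 2 * (1 / (2 * Real.pi)) ^ d * xx n ^ d) =
      1 / 2 * ∫ θ, ∏ i, (Set.Icc (-h) h).indicator (fun _ => (1:ℝ)) (θ i) ∂(muT d) := by
    rw [hP, hh, show 2 * (xx n / 2) = xx n by ring, one_div_pow]
    field_simp
  rw [e, ← integral_const_mul]
  have hmeas : Measurable ((Set.Icc (-h) h).indicator (fun _ => (1:ℝ))) :=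
    measurable_const.indicator measurableSet_Icc
  have h01 : ∀ t, 0 ≤ (Set.Icc (-h) h).indicator (fun _ => (1:ℝ)) t ∧
      (Set.Icc (-h) h).indicator (fun _ => (1:ℝ)) t ≤ 1 := by
    intro t; by_cases ht : t ∈ Set.Icc (-h) h <;> simp [ht]
  have hInt : Integrable (fun θ : Fin d → ℝ =>
      ∏ i, (Set.Icc (-h) h).indicator (fun _ => (1:ℝ)) (θ i)) (muT d) := by
    refine Integrable.of_bound (C := 1) ?_ ?_
    · refine Measurable.aestronglyMeasurable ?_
      refine Finset.measurable_prod _ fun i _ => hmeas.comp (measurable_pi_apply i)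
    · refine Eventually.of_forall fun θ => ?_
      rw [Real.norm_eq_abs, abs_of_nonneg (Finset.prod_nonneg fun i _ => (h01 _).1)]
      exact Finset.prod_le_one (fun i _ => (h01 _).1) fun i _ => (h01 _).2
  refine integral_mono (hInt.const_mul _) (phi_pow_integrable _) fun θ => ?_
  by_cases hθ : ∀ i, θ i ∈ Set.Icc (-h) h
  · simp only [fun i => Set.indicator_of_mem (hθ i) (fun _ => (1:ℝ)), Finset.prod_const_one, mul_one]
    have hphi : 1 - h ^ 2 / 2 ≤ phiT θ := by
      rw [phiT, le_div_iff₀ hd']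
      calc (1 - h ^ 2 / 2) * d = ∑ _i : Fin d, (1 - h ^ 2 / 2) := by simp; ring
        _ ≤ _ := Finset.sum_le_sum fun i _ => by
          have := Real.one_sub_sq_div_two_le_cos (x := θ i)
          have h2 : θ i ^ 2 ≤ h ^ 2 := sq_le_sq' (hθ i).1 (hθ i).2
          linarith
    have hb := one_add_mul_le_pow (a := -(h ^ 2 / 2)) (by nlinarith) (2 * n)
    calc (1 / 2 : ℝ) ≤ 1 + ((2 * n : ℕ) : ℝ) * -(h ^ 2 / 2) := by push_cast; nlinarith
      _ ≤ _ := hb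
      _ ≤ phiT θ ^ (2 * n) := pow_le_pow_left₀ (by nlinarith) (by linarith) _
  · push Not at hθ
    obtain ⟨i, hi⟩ := hθ
    have : ∏ i, (Set.Icc (-h) h).indicator (fun _ => (1:ℝ)) (θ i) = 0 :=
      Finset.prod_eq_zero (Finset.mem_univ i) (Set.indicator_of_notMem hi _)
    simp only [this, mul_zero]
    rw [pow_mul]; positivity

end fourier

/-! ### Elementary sums -/

section sums

lemma xx_anti {m n : ℕ} (h : m ≤ n) : xx n ≤ xx m := by
  unfold xx
  have : (m : ℝ) ≤ n := by exact_mod_cast h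
  gcongr

lemma xx_mul (a b : ℕ) : xx (a + b) ^ 2 ≤ xx a * xx b := by
  have h : xx (a + b) ^ 2 = Real.sqrt ((1 / (1 + (a + b : ℕ) : ℝ)) ^ 2) := by
    rw [Real.sqrt_sq (by positivity), xx_sq]
  have h2 : xx a * xx b = Real.sqrt ((1 / (1 + a : ℝ)) * (1 / (1 + b))) := by
    rw [xx, xx, Real.sqrt_mul (by positivity), Real.sqrt_div (by norm_num),
      Real.sqrt_div (by norm_num), Real.sqrt_one]
  rw [h, h2]
  refine Real.sqrt_le_sqrt ?_
  rw [div_mul_div_comm, div_pow, one_mul, one_pow]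
  refine one_div_le_one_div_of_le (by positivity) ?_
  push_cast
  have ha : (0:ℝ) ≤ a := by positivity
  have hb : (0:ℝ) ≤ b := by positivity
  nlinarith

lemma xx_cube (m : ℕ) : xx m ^ 3 ≤ 4 * (xx m - xx (m + 1)) := by
  unfold xx
  have ha : 0 < Real.sqrt (1 + m) := Real.sqrt_pos.2 (by positivity)
  have hb : 0 < Real.sqrt (1 + ((m + 1 : ℕ) : ℝ)) := Real.sqrt_pos.2 (by positivity)
  have ha2 : Real.sqrt (1 + m) ^ 2 = 1 + m := Real.sq_sqrt (by positivity)
  have hb2 : Real.sqrt (1 + ((m + 1 : ℕ) : ℝ)) ^ 2 = 1 + (m + 1) := by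
    rw [Real.sq_sqrt (by positivity)]; push_cast; ring
  set a := Real.sqrt (1 + m)
  set b := Real.sqrt (1 + ((m + 1 : ℕ) : ℝ))
  have hm : (0:ℝ) ≤ m := by positivity
  have hab : b ^ 2 = a ^ 2 + 1 := by rw [ha2, hb2]; ring
  have e : 4 * (1 / a - 1 / b) = 4 / (a * b * (a + b)) := by
    field_simp
    nlinarith
  rw [e, div_pow, one_pow, div_le_div_iff₀ (by positivity) (by positivity)]
  have h1 : b * (a + b) ≤ 4 * a ^ 2 := by nlinarith [sq_nonneg (a - b)]
  nlinarith [mul_le_mul_of_nonneg_left h1 ha.le]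

lemma xx_tele (k m : ℕ) : xx m ^ (k + 3) ≤ 4 * (xx m ^ (k + 1) - xx (m + 1) ^ (k + 1)) := by
  have h0 := xx_pos m
  have h1 := xx_pos (m + 1)
  have h2 : xx (m + 1) ^ k ≤ xx m ^ k :=
    pow_le_pow_left₀ h1.le (xx_anti (Nat.le_succ m)) k
  calc xx m ^ (k + 3) = xx m ^ k * xx m ^ 3 := by ring
    _ ≤ xx m ^ k * (4 * (xx m - xx (m + 1))) := by gcongr; exact xx_cube m
    _ = 4 * (xx m ^ (k + 1) - xx m ^ k * xx (m + 1)) := by ring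
    _ ≤ _ := by
      rw [pow_succ (xx (m + 1))]
      nlinarith

lemma xx_tail (k n N : ℕ) : ∑ u ∈ Finset.range N, xx (n + u) ^ (k + 3) ≤ 4 * xx n ^ (k + 1) := by
  have : ∑ u ∈ Finset.range N, xx (n + u) ^ (k + 3) ≤
      4 * (xx n ^ (k + 1) - xx (n + N) ^ (k + 1)) := by
    induction N with
    | zero => simp
    | succ N ih =>
      rw [Finset.sum_range_succ]
      have := xx_tele k (n + N)
      rw [← add_assoc]
      linarith
  have h := pow_pos (xx_pos (n + N)) (k + 1)
  linarith

lemma xx_sum (N : ℕ) : ∑ s ∈ Finset.range N, xx s ≤ 2 * Real.sqrt N := by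
  induction N with
  | zero => simp
  | succ N ih =>
    rw [Finset.sum_range_succ]
    have hb : 0 < Real.sqrt (1 + N) := Real.sqrt_pos.2 (by positivity)
    have ha : 0 ≤ Real.sqrt N := Real.sqrt_nonneg _
    have ha2 : Real.sqrt N ^ 2 = N := Real.sq_sqrt (by positivity)
    have hb2 : Real.sqrt (1 + N) ^ 2 = 1 + N := Real.sq_sqrt (by positivity)
    have : xx N ≤ 2 * (Real.sqrt (1 + N) - Real.sqrt N) := by
      rw [xx, div_le_iff₀ hb]
      nlinarith [sq_nonneg (Real.sqrt (1 + N) - Real.sqrt N)]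
    push_cast
    rw [add_comm (N : ℝ) 1]
    linarith

lemma harm_eq (N : ℕ) : ∑ s ∈ Finset.range N, xx s ^ 2 = (harmonic N : ℝ) := by
  simp only [xx_sq, harmonic]
  push_cast
  refine Finset.sum_congr rfl fun s _ => ?_
  rw [one_div, add_comm]

lemma sum_square_symm (c : ℕ → ℕ → ℝ) (hc : ∀ j k, c j k = c k j) (n : ℕ) :
    ∑ j ∈ Finset.range n, ∑ k ∈ Finset.range n, c j k =
      2 * ∑ j ∈ Finset.range n, ∑ k ∈ Finset.Ico j n, c j k - ∑ j ∈ Finset.range n, c j j := by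
  induction n with
  | zero => simp
  | succ n ih =>
    rw [Finset.sum_range_succ, Finset.sum_range_succ _ n, Finset.sum_range_succ _ n,
      Finset.sum_range_succ _ n]
    simp only [Finset.sum_range_succ _ n, Finset.sum_add_distrib]
    have h1 : ∑ j ∈ Finset.range n, ∑ k ∈ Finset.Ico j (n + 1), c j k =
        ∑ j ∈ Finset.range n, ∑ k ∈ Finset.Ico j n, c j k + ∑ j ∈ Finset.range n, c j n := by
      rw [← Finset.sum_add_distrib]
      refine Finset.sum_congr rfl fun j hj => ?_
      rw [Finset.sum_Ico_succ_top (Finset.mem_range.1 hj).le]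
    rw [h1, ih]
    simp only [hc n]
    simp
    ring

end sums

/-! ### Second moment of the Green sum in dimension four -/

/-- Triple overlap. -/
def tt {d : ℕ} (a b c : ℕ) : ℝ :=
  EL (2 * a) (fun w : List (Step d) => pp (2 * b) (SS w) * pp (2 * c) (SS w))

/-- Truncated Green function at even times. -/
def GG {d : ℕ} (M : ℕ) (x : Zd d) : ℝ := ∑ u ∈ Finset.range (M + 1), pp (2 * u) x

/-- Shifted truncated Green function. -/
def hh {d : ℕ} (M i : ℕ) (x : Zd d) : ℝ := ∑ u ∈ Finset.range (M + 1), pp (2 * (i + u)) x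

/-- Green sum along a walk. -/
def DD {d : ℕ} (M : ℕ) (w : List (Step d)) : ℝ :=
  ∑ k ∈ Finset.range (M + 1), GG M (SS (w.take (2 * k)))

/-- Mean of the Green sum. -/
def eD (d M : ℕ) : ℝ := ∑ k ∈ Finset.range (M + 1), hh M k (0 : Zd d)

section second
variable {d : ℕ}

lemma EL_swap (m n : ℕ) (f : Zd d → ℝ) :
    EL m (fun w => f (SS w) * pp n (SS w)) = EL n (fun w => f (SS w) * pp m (SS w)) := by
  simp only [pp, ← EL_mul_left]
  rw [EL_comm]
  congr 1; ext v; congr 1; ext u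
  by_cases h : SS v = SS u
  · simp [h]
  · simp [h, Ne.symm h]

lemma tt_b {a b c : ℕ} {β : ℝ} (h : ∀ x : Zd d, pp (2 * b) x ≤ β) :
    tt (d := d) a b c ≤ β * pp (2 * (a + c)) (0 : Zd d) := by
  rw [show 2 * (a + c) = 2 * a + 2 * c by ring, ← EL_pp_add, ← EL_mul_left]
  refine EL_mono fun w _ => ?_
  rw [zero_add]
  exact mul_le_mul_of_nonneg_right (h _) (pp_nonneg _ _)

lemma tt_symm (a b c : ℕ) : tt (d := d) a b c = tt (d := d) a c b := by
  simp only [tt, mul_comm]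

lemma tt_swap (a b c : ℕ) : tt (d := d) a b c = tt (d := d) c b a := by
  rw [tt, EL_swap (f := fun x => pp (2 * b) x)]; rfl

lemma pp_even4 {C : ℝ} (hC : 0 < C) (h : ∀ n (x : Zd d), pp n x ≤ C * xx n ^ 4) (n : ℕ) (x : Zd d) :
    pp (2 * n) x ≤ C * xx n ^ 4 := by
  refine (h _ x).trans ?_
  have := xx_anti (show n ≤ 2 * n by omega)
  have := (xx_pos (2 * n)).le
  gcongr

lemma tt_b' {C : ℝ} (hC : 0 < C) (h : ∀ n (x : Zd d), pp n x ≤ C * xx n ^ 4) (a b c : ℕ) :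
    tt (d := d) a b c ≤ C ^ 2 * (xx b ^ 4 * xx (a + c) ^ 4) := by
  refine (tt_b (pp_even4 hC h b)).trans ?_
  have := pp_even4 hC h (a + c) 0
  have h1 := (xx_pos b).le
  calc C * xx b ^ 4 * pp (2 * (a + c)) (0 : Zd d) ≤ C * xx b ^ 4 * (C * xx (a + c) ^ 4) := by gcongr
    _ = _ := by ring

lemma xx_double {a b : ℕ} (h : b ≤ a) : xx a ^ 4 ≤ 4 * xx (a + b) ^ 4 := by
  have h1 : xx a ^ 2 ≤ 2 * xx (a + b) ^ 2 := by
    rw [xx_sq, xx_sq, mul_one_div, div_le_div_iff₀ (by positivity) (by positivity)]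
    have : (b : ℝ) ≤ a := by exact_mod_cast h
    push_cast
    linarith
  calc xx a ^ 4 = (xx a ^ 2) ^ 2 := by ring
    _ ≤ (2 * xx (a + b) ^ 2) ^ 2 := by gcongr
    _ = _ := by ring

lemma tt_bound {C : ℝ} (hC : 0 < C) (h : ∀ n (x : Zd d), pp n x ≤ C * xx n ^ 4) (j u i v : ℕ) :
    tt (d := d) j u (i + v) ≤ C ^ 2 * (4 * (xx (j + i + v) ^ 4 * xx (j + u) ^ 4) +
      if v < j then xx j ^ 4 * xx (i + v + u) ^ 4 else 0) := by
  have p : ∀ n, 0 < xx n ^ 4 := fun n => pow_pos (xx_pos n) 4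
  have hif : 0 ≤ (if v < j then xx j ^ 4 * xx (i + v + u) ^ 4 else 0) := by
    split_ifs
    · have := p j; have := p (i + v + u); positivity
    · rfl
  have p1 : 0 ≤ 4 * (xx (j + i + v) ^ 4 * xx (j + u) ^ 4) := by
    have := p (j + i + v); have := p (j + u); positivity
  rcases le_or_gt j (i + v) with h1 | h1
  · rw [tt_symm]
    refine (tt_b' hC h _ _ _).trans ?_
    have h2 := xx_double h1
    rw [show i + v + j = j + i + v by ring] at h2
    have := p (j + u)
    gcongr
    nlinarith
  · rcases le_or_gt j u with h2 | h2
    · refine (tt_b' hC h _ _ _).trans ?_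
      have h2 := xx_double h2
      rw [show u + j = j + u by ring] at h2
      have := p (j + i + v)
      rw [← add_assoc]
      gcongr
      nlinarith
    · have h3 : v < j := by omega
      rw [if_pos h3, tt_symm, tt_swap, tt_symm]
      have := tt_b' hC h u j (i + v)
      rw [show u + (i + v) = i + v + u by ring] at this
      refine this.trans ?_
      gcongr
      linarith

lemma j_xx (j : ℕ) : (j : ℝ) * xx j ^ 2 ≤ 1 := by
  rw [xx_sq, mul_one_div, div_le_one (by positivity)]; linarith

lemma cov_sum {C : ℝ} (hC : 0 < C) (h : ∀ n (x : Zd d), pp n x ≤ C * xx n ^ 4) (M j : ℕ) :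
    ∑ i ∈ Finset.range j, EL (2 * j) (fun w : List (Step d) => GG M (SS w) * hh M i (SS w)) ≤
      80 * C ^ 2 * xx j ^ 2 := by
  have e : ∀ i, EL (2 * j) (fun w : List (Step d) => GG M (SS w) * hh M i (SS w)) =
      ∑ v ∈ Finset.range (M + 1), ∑ u ∈ Finset.range (M + 1), tt (d := d) j u (i + v) := by
    intro i
    simp only [GG, hh, tt, Finset.sum_mul_sum, EL_sum]
    rw [Finset.sum_comm]
  simp only [e]
  have xp := fun n => (xx_pos n).le
  calc ∑ i ∈ Finset.range j, ∑ v ∈ Finset.range (M + 1), ∑ u ∈ Finset.range (M + 1),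
        tt (d := d) j u (i + v)
      ≤ ∑ i ∈ Finset.range j, ∑ v ∈ Finset.range (M + 1), ∑ u ∈ Finset.range (M + 1),
        C ^ 2 * (4 * (xx (j + i + v) ^ 4 * xx (j + u) ^ 4) +
          if v < j then xx j ^ 4 * xx (i + v + u) ^ 4 else 0) :=
        Finset.sum_le_sum fun i _ => Finset.sum_le_sum fun v _ => Finset.sum_le_sum fun u _ =>
          tt_bound hC h j u i v
    _ = C ^ 2 * (4 * (∑ i ∈ Finset.range j, ∑ v ∈ Finset.range (M + 1), xx (j + i + v) ^ 4) *
          (∑ u ∈ Finset.range (M + 1), xx (j + u) ^ 4) +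
          xx j ^ 4 * ∑ i ∈ Finset.range j, ∑ v ∈ Finset.range (M + 1),
            if v < j then ∑ u ∈ Finset.range (M + 1), xx (i + v + u) ^ 4 else 0) := by
        simp only [← Finset.mul_sum, Finset.sum_add_distrib]
        congr 2
        · simp only [← Finset.mul_sum, ← Finset.sum_mul]; ring
        · simp only [Finset.mul_sum]
          refine Finset.sum_congr rfl fun i _ => Finset.sum_congr rfl fun v _ => ?_
          split_ifs
          · rw [Finset.mul_sum]
          · simp
    _ ≤ C ^ 2 * (4 * (∑ i ∈ Finset.range j, 4 * xx j ^ 2) * (4 * xx j ^ 2) +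
          xx j ^ 4 * ∑ i ∈ Finset.range j, ∑ v ∈ Finset.range j, 4 * (xx i * xx v)) := by
        have a1 : ∑ i ∈ Finset.range j, ∑ v ∈ Finset.range (M + 1), xx (j + i + v) ^ 4 ≤
            ∑ i ∈ Finset.range j, 4 * xx j ^ 2 := by
          refine Finset.sum_le_sum fun i _ => (xx_tail 1 (j + i) (M + 1)).trans ?_
          have := xx_anti (show j ≤ j + i by omega)
          have := xp (j + i)
          gcongr
        have a2 : ∑ u ∈ Finset.range (M + 1), xx (j + u) ^ 4 ≤ 4 * xx j ^ 2 := xx_tail 1 j (M + 1)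
        have a3 : ∑ i ∈ Finset.range j, ∑ v ∈ Finset.range (M + 1),
            (if v < j then ∑ u ∈ Finset.range (M + 1), xx (i + v + u) ^ 4 else 0) ≤
            ∑ i ∈ Finset.range j, ∑ v ∈ Finset.range j, 4 * (xx i * xx v) := by
          refine Finset.sum_le_sum fun i _ => ?_
          rw [← Finset.sum_filter]
          refine (Finset.sum_le_sum fun v _ => (xx_tail 1 (i + v) (M + 1)).trans
            (mul_le_mul_of_nonneg_left (xx_mul i v) (by norm_num))).trans ?_
          refine Finset.sum_le_sum_of_subset_of_nonneg ?_ ?_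
          · intro v hv; simp at hv ⊢; exact hv.2
          · intro v _ _; have := xp i; have := xp v; positivity
        have a4 : 0 ≤ ∑ u ∈ Finset.range (M + 1), xx (j + u) ^ 4 :=
          Finset.sum_nonneg fun u _ => by have := xp (j + u); positivity
        have a5 : 0 ≤ ∑ i ∈ Finset.range j, 4 * xx j ^ 2 :=
          Finset.sum_nonneg fun u _ => by positivity
        have := xp j
        gcongr
    _ ≤ C ^ 2 * (4 * (j * (4 * xx j ^ 2)) * (4 * xx j ^ 2) + xx j ^ 4 * (16 * j)) := by
        have b1 : ∑ i ∈ Finset.range j, ∑ v ∈ Finset.range j, 4 * (xx i * xx v) =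
            4 * (∑ i ∈ Finset.range j, xx i) ^ 2 := by
          rw [sq, Finset.sum_mul_sum]; simp only [Finset.mul_sum]
        have b2 : (∑ i ∈ Finset.range j, xx i) ^ 2 ≤ (2 * Real.sqrt j) ^ 2 :=
          pow_le_pow_left₀ (Finset.sum_nonneg fun i _ => xp i) (xx_sum j) 2
        rw [mul_pow, Real.sq_sqrt (by positivity)] at b2
        have b3 : ∑ i ∈ Finset.range j, ∑ v ∈ Finset.range j, 4 * (xx i * xx v) ≤ 16 * j := by
          rw [b1]; linarith
        rw [Finset.sum_const, Finset.card_range, nsmul_eq_mul]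
        have := xp j
        gcongr
    _ = (80 * C ^ 2 * xx j ^ 2) * (j * xx j ^ 2) := by ring
    _ ≤ (80 * C ^ 2 * xx j ^ 2) * 1 := by
        have := j_xx j
        gcongr
    _ = _ := by ring

lemma GG_nonneg (M : ℕ) (x : Zd d) : 0 ≤ GG M x := Finset.sum_nonneg fun _ _ => pp_nonneg _ _
lemma hh_nonneg (M i : ℕ) (x : Zd d) : 0 ≤ hh M i x := Finset.sum_nonneg fun _ _ => pp_nonneg _ _

lemma EL_GG_add (M i : ℕ) (x : Zd d) :
    EL (2 * i) (fun w => GG M (x + SS w)) = hh M i x := by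
  simp only [GG, hh, EL_sum, EL_pp_add, mul_add]

lemma EL_GG {L : ℕ} (hd : 0 < d) (M k : ℕ) (hk : 2 * k ≤ L) :
    EL L (fun w : List (Step d) => GG M (SS (w.take (2 * k)))) = hh M k (0 : Zd d) := by
  rw [EL_take hd hk (fun w => GG M (SS w)), ← EL_GG_add]
  simp only [zero_add]

lemma EL_GG2 {L : ℕ} (hd : 0 < d) (M j i : ℕ) (hk : 2 * (j + i) ≤ L) :
    EL L (fun w : List (Step d) => GG M (SS (w.take (2 * j))) * GG M (SS (w.take (2 * (j + i))))) =
      EL (2 * j) (fun w : List (Step d) => GG M (SS w) * hh M i (SS w)) := by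
  have : (fun w : List (Step d) => GG M (SS (w.take (2 * j))) * GG M (SS (w.take (2 * (j + i))))) =
      fun w => (fun w' : List (Step d) => GG M (SS (w'.take (2 * j))) * GG M (SS w'))
        (w.take (2 * (j + i))) := by
    funext w
    simp only [List.take_take]
    rw [show min (2 * j) (2 * (j + i)) = 2 * j by omega]
  rw [this, EL_take hd hk (fun w' : List (Step d) => GG M (SS (w'.take (2 * j))) * GG M (SS w'))]
  rw [show 2 * (j + i) = 2 * j + 2 * i by ring, EL_append]
  refine EL_congr fun u hu => ?_
  rw [← EL_GG_add, ← EL_mul_left]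
  refine EL_congr fun v _ => ?_
  rw [SS_append, ← hu, List.take_left]

lemma eD_mean {L : ℕ} (hd : 0 < d) (M : ℕ) (hL : 2 * M ≤ L) :
    EL L (fun w : List (Step d) => DD M w) = eD d M := by
  simp only [DD, EL_sum, eD]
  refine Finset.sum_congr rfl fun k hk => EL_GG hd M k ?_
  have := Finset.mem_range.1 hk
  omega

lemma cov_row {C : ℝ} (hd : 0 < d) (hC : 0 < C) (h : ∀ n (x : Zd d), pp n x ≤ C * xx n ^ 4)
    {L : ℕ} (M j : ℕ) (hj : j < M + 1) (hL : 2 * M ≤ L) :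
    ∑ k ∈ Finset.Ico j (M + 1),
      (EL L (fun w : List (Step d) => GG M (SS (w.take (2 * j))) * GG M (SS (w.take (2 * k)))) -
        hh M j (0 : Zd d) * hh M k (0 : Zd d)) ≤ 80 * C ^ 2 * xx j ^ 2 := by
  rw [Finset.sum_sub_distrib, ← Finset.mul_sum, Finset.sum_Ico_eq_sum_range]
  set A : ℕ → ℝ := fun i => EL (2 * j) (fun w : List (Step d) => GG M (SS w) * hh M i (SS w))
    with hA
  have hA0 : ∀ i, 0 ≤ A i := fun i => EL_nonneg fun w _ =>
    mul_nonneg (GG_nonneg _ _) (hh_nonneg _ _ _)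
  have e1 : ∑ i ∈ Finset.range (M + 1 - j),
      EL L (fun w : List (Step d) => GG M (SS (w.take (2 * j))) * GG M (SS (w.take (2 * (j + i))))) =
      ∑ i ∈ Finset.range (M + 1 - j), A i := by
    refine Finset.sum_congr rfl fun i hi => EL_GG2 hd M j i ?_
    have := Finset.mem_range.1 hi
    omega
  rw [e1]
  have hAle : ∀ i, A i ≤ hh M j (0 : Zd d) * hh M i (0 : Zd d) := by
    intro i
    rw [← EL_GG_add M j 0, ← EL_mul_right]
    refine EL_mono fun w _ => ?_
    rw [zero_add]
    refine mul_le_mul_of_nonneg_left ?_ (GG_nonneg _ _)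
    exact Finset.sum_le_sum fun u _ => pp_even_le hd _ _
  have s1 : ∑ i ∈ Finset.range (M + 1 - j), A i ≤
      ∑ i ∈ Finset.range j, A i + ∑ i ∈ Finset.Ico j (M + 1), A i := by
    rw [Finset.range_eq_Ico, Finset.range_eq_Ico, Finset.sum_Ico_consecutive _ (Nat.zero_le _) hj.le]
    refine Finset.sum_le_sum_of_subset_of_nonneg ?_ fun i _ _ => hA0 i
    intro i; simp; omega
  have s2 : ∑ i ∈ Finset.Ico j (M + 1), A i ≤
      hh M j (0 : Zd d) * ∑ i ∈ Finset.Ico j (M + 1), hh M i (0 : Zd d) := by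
    rw [Finset.mul_sum]; exact Finset.sum_le_sum fun i _ => hAle i
  have s3 := cov_sum hC h M j
  linarith

lemma hh_bound {C : ℝ} (hC : 0 < C) (h : ∀ n (x : Zd d), pp n x ≤ C * xx n ^ 4) (M j : ℕ) :
    hh M j (0 : Zd d) ≤ 4 * C * xx j ^ 2 := by
  calc hh M j (0 : Zd d) ≤ ∑ u ∈ Finset.range (M + 1), C * xx (j + u) ^ 4 :=
        Finset.sum_le_sum fun u _ => pp_even4 hC h _ _
    _ = C * ∑ u ∈ Finset.range (M + 1), xx (j + u) ^ 4 := by rw [Finset.mul_sum]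
    _ ≤ C * (4 * xx j ^ 2) := by gcongr; exact xx_tail 1 j (M + 1)
    _ = _ := by ring

lemma var_bound {C : ℝ} (hd : 0 < d) (hC : 0 < C) (h : ∀ n (x : Zd d), pp n x ≤ C * xx n ^ 4)
    {L : ℕ} (M : ℕ) (hL : 2 * M ≤ L) :
    EL L (fun w : List (Step d) => (DD M w - eD d M) ^ 2) ≤
      176 * C ^ 2 * ∑ j ∈ Finset.range (M + 1), xx j ^ 2 := by
  have e0 : EL L (fun w : List (Step d) => (DD M w - eD d M) ^ 2) =
      EL L (fun w : List (Step d) => DD M w ^ 2) - eD d M ^ 2 := by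
    have : ∀ w : List (Step d), (DD M w - eD d M) ^ 2 =
      DD M w ^ 2 + ((-2 * eD d M) * DD M w + eD d M ^ 2) := fun w => by ring
    simp only [this]
    rw [EL_add, EL_add, EL_mul_left, EL_const hd, eD_mean hd M hL]
    ring
  set c : ℕ → ℕ → ℝ := fun j k =>
    EL L (fun w : List (Step d) => GG M (SS (w.take (2 * j))) * GG M (SS (w.take (2 * k)))) -
        hh M j (0 : Zd d) * hh M k (0 : Zd d) with hc
  have e1 : EL L (fun w : List (Step d) => DD M w ^ 2) - eD d M ^ 2 =
      ∑ j ∈ Finset.range (M + 1), ∑ k ∈ Finset.range (M + 1), c j k := by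
    simp only [hc, Finset.sum_sub_distrib]
    congr 1
    · simp only [sq, DD, Finset.sum_mul_sum, EL_sum]
    · simp only [sq, eD, Finset.sum_mul_sum]
  rw [e0, e1, sum_square_symm c (fun j k => by simp only [hc, mul_comm])]
  have h1 : ∑ j ∈ Finset.range (M + 1), ∑ k ∈ Finset.Ico j (M + 1), c j k ≤
      ∑ j ∈ Finset.range (M + 1), 80 * C ^ 2 * xx j ^ 2 :=
    Finset.sum_le_sum fun j hj => cov_row hd hC h M j (Finset.mem_range.1 hj) hL
  have h2 : ∑ j ∈ Finset.range (M + 1), -(c j j) ≤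
      ∑ j ∈ Finset.range (M + 1), 16 * C ^ 2 * xx j ^ 2 := by
    refine Finset.sum_le_sum fun j _ => ?_
    have a1 : 0 ≤ EL L (fun w : List (Step d) =>
        GG M (SS (w.take (2 * j))) * GG M (SS (w.take (2 * j)))) :=
      EL_nonneg fun w _ => mul_self_nonneg _
    have a2 := hh_bound hC h M j
    have a3 := hh_nonneg M j (0 : Zd d)
    have a4 : hh M j (0 : Zd d) * hh M j (0 : Zd d) ≤ (4 * C * xx j ^ 2) * (4 * C * xx j ^ 2) := by
      gcongr
    have a5 : xx j ^ 2 ≤ 1 := pow_le_one₀ (xx_pos j).le (xx_le_one j)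
    have a6 : (4 * C * xx j ^ 2) * (4 * C * xx j ^ 2) ≤ (16 * C ^ 2 * xx j ^ 2) * 1 := by
      calc (4 * C * xx j ^ 2) * (4 * C * xx j ^ 2) = (16 * C ^ 2 * xx j ^ 2) * xx j ^ 2 := by ring
        _ ≤ _ := by gcongr
    simp only [hc]
    linarith
  rw [Finset.sum_neg_distrib, ← Finset.mul_sum] at h2
  rw [← Finset.mul_sum] at h1
  linarith

lemma eD_lower {c : ℝ} (hc : 0 < c) (h : ∀ n, c * xx n ^ 4 ≤ pp (2 * n) (0 : Zd d)) (M : ℕ) :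
    c / 4 * ∑ j ∈ Finset.range (M + 1), xx j ^ 2 ≤ eD d M := by
  rw [eD, Finset.mul_sum]
  refine Finset.sum_le_sum fun k hk => ?_
  have hk' := Finset.mem_range.1 hk
  calc c / 4 * xx k ^ 2 ≤ ∑ _u ∈ Finset.range (k + 1), c * xx (k + k) ^ 4 := by
        rw [Finset.sum_const, Finset.card_range, nsmul_eq_mul]
        rw [show xx (k + k) ^ 4 = (xx (k + k) ^ 2) ^ 2 by ring, xx_sq, xx_sq, div_pow, one_pow]
        push_cast
        rw [div_mul_div_comm, mul_one_div, mul_div_assoc', div_le_div_iff₀ (by positivity) (by positivity)]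
        have : (0:ℝ) ≤ k := by positivity
        nlinarith [mul_nonneg hc.le this]
    _ ≤ ∑ u ∈ Finset.range (k + 1), c * xx (k + u) ^ 4 := by
        refine Finset.sum_le_sum fun u hu => ?_
        have := xx_anti (show k + u ≤ k + k by have := Finset.mem_range.1 hu; omega)
        have := (xx_pos (k + k)).le
        gcongr
    _ ≤ ∑ u ∈ Finset.range (M + 1), c * xx (k + u) ^ 4 := by
        refine Finset.sum_le_sum_of_subset_of_nonneg ?_ ?_
        · intro u; simp; omega
        · intro u _ _; have := xx_pos (k + u); positivity
    _ ≤ _ := Finset.sum_le_sum fun u _ => h _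

end second

/-! ### Avoidance probabilities -/

/-- Probability that the walk from `x` avoids `A` at times `1, …, m`. -/
def av {d : ℕ} (A : Set (Zd d)) : ℕ → Zd d → ℝ
  | 0, _ => 1
  | m + 1, x => avg (fun s => if x + sv s ∈ A then 0 else av A m (x + sv s))

section avoid
variable {d : ℕ}

lemma av_succ (A : Set (Zd d)) (m : ℕ) (x : Zd d) :
    av A (m + 1) x = avg (fun s => if x + sv s ∈ A then 0 else av A m (x + sv s)) := rfl

lemma avg_nonneg {f : Step d → ℝ} (h : ∀ s, 0 ≤ f s) : 0 ≤ avg f := by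
  unfold avg
  have := Finset.sum_nonneg fun s (_ : s ∈ Finset.univ) => h s
  positivity

lemma av_nonneg (A : Set (Zd d)) (m : ℕ) (x : Zd d) : 0 ≤ av A m x := by
  induction m generalizing x with
  | zero => exact zero_le_one
  | succ m ih =>
    refine avg_nonneg fun s => ?_
    split_ifs
    · rfl
    · exact ih _

lemma av_le_one (hd : 0 < d) (A : Set (Zd d)) (m : ℕ) (x : Zd d) : av A m x ≤ 1 := by
  induction m generalizing x with
  | zero => exact le_rfl
  | succ m ih =>
    rw [av_succ, ← avg_const hd 1]
    refine avg_mono fun s => ?_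
    split_ifs
    · exact zero_le_one
    · exact ih _

lemma av_anti_set {A B : Set (Zd d)} (h : A ⊆ B) (m : ℕ) (x : Zd d) : av B m x ≤ av A m x := by
  induction m generalizing x with
  | zero => exact le_rfl
  | succ m ih =>
    refine avg_mono fun s => ?_
    by_cases h1 : x + sv s ∈ A
    · rw [if_pos h1, if_pos (h h1)]
    · rw [if_neg h1]
      split_ifs
      · exact av_nonneg _ _ _
      · exact ih _

lemma av_anti_succ (hd : 0 < d) (A : Set (Zd d)) (m : ℕ) (x : Zd d) : av A (m + 1) x ≤ av A m x := by
  induction m generalizing x with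
  | zero => exact av_le_one hd _ _ _
  | succ m ih =>
    refine avg_mono fun s => ?_
    split_ifs
    · rfl
    · exact ih _

lemma av_anti (hd : 0 < d) (A : Set (Zd d)) {m n : ℕ} (h : m ≤ n) (x : Zd d) : av A n x ≤ av A m x :=
  antitone_nat_of_succ_le (f := fun m => av A m x) (fun m => av_anti_succ hd A m x) h

lemma av_shift (A : Set (Zd d)) (m : ℕ) (x a : Zd d) :
    av A m (x + a) = av {z | z + a ∈ A} m x := by
  induction m generalizing x with
  | zero => rfl
  | succ m ih =>
    simp only [av_succ]
    congr 1; ext s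
    rw [show x + a + sv s = (x + sv s) + a by abel, ih]
    rfl

lemma last_exit (hd : 0 < d) (A : Finset (Zd d)) (m : ℕ) (y : Zd d) :
    ∑ u ∈ Finset.range (m + 1), ∑ x ∈ A, pp u (x - y) * av (↑A) (m - u) x =
      1 - if y ∈ (A : Set (Zd d)) then 0 else av (↑A) m y := by
  have z0 : ∀ m, ∑ x ∈ A, pp 0 (x - y) * av (↑A) m x =
      if y ∈ (A : Set (Zd d)) then av (↑A) m y else 0 := by
    intro m
    simp only [pp_zero, sub_eq_zero, ite_mul, one_mul, zero_mul]
    rw [Finset.sum_ite_eq']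
    simp
  induction m generalizing y with
  | zero =>
    rw [zero_add, Finset.sum_range_one, z0]
    split_ifs <;> simp [av]
  | succ m ih =>
    rw [Finset.sum_range_succ', Nat.sub_zero, z0]
    have e : ∑ u ∈ Finset.range (m + 1), ∑ x ∈ A, pp (u + 1) (x - y) * av (↑A) (m + 1 - (u + 1)) x
        = avg (fun s : Step d => 1 - if y + sv s ∈ (A : Set (Zd d)) then 0 else av (↑A) m (y + sv s)) := by
      have : ∀ s : Step d, (1 - if y + sv s ∈ (A : Set (Zd d)) then 0 else av (↑A) m (y + sv s)) =
        ∑ u ∈ Finset.range (m + 1), ∑ x ∈ A, pp u (x - (y + sv s)) * av (↑A) (m - u) x := by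
        intro s
        refine (ih (y + sv s) ?_).symm
        intro m
        simp only [pp_zero, sub_eq_zero, ite_mul, one_mul, zero_mul]
        rw [Finset.sum_ite_eq']
        simp
      simp only [this, avg_sum]
      refine Finset.sum_congr rfl fun u _ => Finset.sum_congr rfl fun x _ => ?_
      rw [pp_succ, Nat.add_sub_add_right, mul_comm, ← avg_mul_left]
      congr 1; ext s
      rw [mul_comm, sub_sub]
    rw [e]
    have e2 : avg (fun s : Step d => 1 - if y + sv s ∈ (A : Set (Zd d)) then 0 else av (↑A) m (y + sv s))
        = 1 - av (↑A) (m + 1) y := by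
      have h1 := avg_add (fun s : Step d => 1 - if y + sv s ∈ (A : Set (Zd d)) then 0 else av (↑A) m (y + sv s))
        (fun s : Step d => if y + sv s ∈ (A : Set (Zd d)) then 0 else av (↑A) m (y + sv s))
      simp only [sub_add_cancel, avg_const hd] at h1
      rw [av_succ]
      refine eq_sub_of_add_eq ?_
      convert h1.symm
    rw [e2]
    split_ifs <;> ring

lemma last_exit_le (hd : 0 < d) (A : Finset (Zd d)) (m : ℕ) (y : Zd d) :
    ∑ x ∈ A, av (↑A) m x * ∑ u ∈ Finset.range (m + 1), pp u (x - y) ≤ 1 := by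
  have h := last_exit hd A m y
  have h2 : (0:ℝ) ≤ if y ∈ (A : Set (Zd d)) then 0 else av (↑A) m y := by
    split_ifs
    · rfl
    · exact av_nonneg _ _ _
  refine le_trans ?_ (h.le.trans (by linarith))
  simp only [Finset.mul_sum]
  rw [Finset.sum_comm]
  refine Finset.sum_le_sum fun u _ => Finset.sum_le_sum fun x _ => ?_
  rw [mul_comm]
  exact mul_le_mul_of_nonneg_left (av_anti hd _ (Nat.sub_le _ _) _) (pp_nonneg _ _)

/-- Decomposition of the range according to last visits. -/
lemma sum_image_last (X : ℕ → Zd d) (T : ℕ) (f : Zd d → ℝ) :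
    ∑ x ∈ (Finset.range (T + 1)).image X, f x =
      ∑ s ∈ Finset.range (T + 1), if ∀ t, s < t → t ≤ T → X t ≠ X s then f (X s) else 0 := by
  rw [← Finset.sum_filter]
  have : (Finset.range (T + 1)).image X =
      ((Finset.range (T + 1)).filter (fun s => ∀ t, s < t → t ≤ T → X t ≠ X s)).image X := by
    ext x
    simp only [Finset.mem_image, Finset.mem_range, Finset.mem_filter]
    constructor
    · rintro ⟨s, hs, rfl⟩
      have hne : ((Finset.range (T + 1)).filter (fun t => X t = X s)).Nonempty :=
        ⟨s, by simp [hs]⟩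
      obtain ⟨k, hk, hmax⟩ := Finset.exists_max_image _ id hne
      simp only [Finset.mem_filter, Finset.mem_range, id] at hk hmax
      refine ⟨k, ⟨hk.1, fun t h1 h2 h3 => ?_⟩, hk.2⟩
      have := hmax t ⟨by omega, h3.trans hk.2⟩
      omega
    · rintro ⟨s, hs, rfl⟩
      exact ⟨s, hs.1, rfl⟩
  rw [this, Finset.sum_image]
  intro a ha b hb hab
  simp only [Finset.coe_filter, Finset.mem_range, Set.mem_ofPred_eq] at ha hb
  by_contra hne
  rcases Nat.lt_or_gt_of_ne hne with h | h
  · exact ha.2 b h (by omega) hab.symm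
  · exact hb.2 a h (by omega) hab

/-- Time `s` is a last-visit time of the word `w`. -/
def lastV (s : ℕ) (w : List (Step d)) : Prop :=
  ∀ t, s < t → t ≤ w.length → SS (w.take t) ≠ SS (w.take s)

/-- The range of the word seen from time `s`. -/
def rg (s : ℕ) (w : List (Step d)) : Set (Zd d) :=
  {z | ∃ t ≤ w.length, z + SS (w.take s) = SS (w.take t)}

/-- Escape probability from the range at a last-visit time. -/
def ev (m s : ℕ) (w : List (Step d)) : ℝ := if lastV s w then av (rg s w) m 0 else 0

lemma ev_nonneg (m s : ℕ) (w : List (Step d)) : 0 ≤ ev m s w := by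
  unfold ev; split_ifs
  · exact av_nonneg _ _ _
  · rfl

lemma ev_le_one (hd : 0 < d) (m s : ℕ) (w : List (Step d)) : ev m s w ≤ 1 := by
  unfold ev; split_ifs
  · exact av_le_one hd _ _ _
  · exact zero_le_one

lemma ev_mono {m s s' : ℕ} {w w' : List (Step d)} (h1 : lastV s w → lastV s' w')
    (h2 : rg s' w' ⊆ rg s w) : ev m s w ≤ ev m s' w' := by
  unfold ev
  by_cases h : lastV s w
  · rw [if_pos h, if_pos (h1 h)]
    exact av_anti_set h2 _ _
  · rw [if_neg h]; exact ev_nonneg _ _ _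

lemma take_pre (w1 w' : List (Step d)) (t : ℕ) :
    SS ((w1 ++ w').take (w1.length + t)) = SS w1 + SS (w'.take t) := by
  rw [List.take_length_add_append, SS_append]

lemma ev_pre (m s : ℕ) (w1 w' : List (Step d)) :
    ev m (w1.length + s) (w1 ++ w') ≤ ev m s w' := by
  refine ev_mono ?_ ?_
  · intro h t h1 h2 h3
    refine h (w1.length + t) (by omega) (by simp; omega) ?_
    rw [take_pre, take_pre, h3]
  · rintro z ⟨t, ht, hz⟩
    refine ⟨w1.length + t, by simp; omega, ?_⟩
    rw [take_pre, take_pre, ← hz]; abel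

lemma ev_suf (m s : ℕ) (w' w2 : List (Step d)) (hs : s ≤ w'.length) :
    ev m s (w' ++ w2) ≤ ev m s w' := by
  have tk : ∀ t ≤ w'.length, (w' ++ w2).take t = w'.take t := fun t ht =>
    List.take_append_of_le_length ht
  refine ev_mono ?_ ?_
  · intro h t h1 h2 h3
    refine h t h1 (by simp; omega) ?_
    rw [tk _ h2, tk _ hs, h3]
  · rintro z ⟨t, ht, hz⟩
    refine ⟨t, by simp; omega, ?_⟩
    rw [tk _ ht, tk _ hs, hz]

lemma ev_mid (m s : ℕ) (w1 w' w2 : List (Step d)) (hs : s ≤ w'.length) :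
    ev m (w1.length + s) (w1 ++ (w' ++ w2)) ≤ ev m s w' :=
  (ev_pre _ _ _ _).trans (ev_suf _ _ _ _ hs)

/-- Mean escape probability. -/
def qq (d a b m : ℕ) : ℝ := EL (a + b) (fun w : List (Step d) => ev m a w)

lemma qq_mono (hd : 0 < d) {a b a' b' : ℕ} (ha : a ≤ a') (hb : b ≤ b') (m : ℕ) :
    qq d a' b' m ≤ qq d a b m := by
  obtain ⟨p, rfl⟩ := Nat.exists_eq_add_of_le ha
  obtain ⟨r, rfl⟩ := Nat.exists_eq_add_of_le hb
  unfold qq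
  rw [show a + p + (b + r) = p + ((a + b) + r) by ring, EL_append]
  rw [← EL_const hd p (EL (a + b) fun w => ev m a w)]
  refine EL_mono fun u hu => ?_
  rw [EL_append]
  refine EL_mono fun v hv => ?_
  rw [← EL_const hd r (ev m a v)]
  refine EL_mono fun w _ => ?_
  have := ev_mid m a u v w (by omega)
  rwa [hu, add_comm p a] at this

/-- The range of a path started at `y`. -/
def path (y : Zd d) (w : List (Step d)) (t : ℕ) : Zd d := y + SS (w.take t)

lemma av_path (y : Zd d) (w : List (Step d)) (m s : ℕ) :
    av (↑((Finset.range (w.length + 1)).image (path y w))) m (path y w s) = av (rg s w) m 0 := by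
  rw [← zero_add (path y w s), av_shift]
  congr 1
  ext z
  simp only [Finset.coe_image, Finset.coe_range, Set.mem_image, Set.mem_Iio, Set.mem_ofPred_eq, rg,
    path, Nat.lt_succ_iff]
  constructor
  · rintro ⟨t, ht, h⟩
    refine ⟨t, ht, ?_⟩
    have : y + SS (w.take t) = y + (z + SS (w.take s)) := by rw [h]; abel
    exact (add_left_cancel this).symm
  · rintro ⟨t, ht, h⟩
    exact ⟨t, ht, by rw [← h]; abel⟩

lemma lastV_path (y : Zd d) (w : List (Step d)) (s : ℕ) :
    (∀ t, s < t → t ≤ w.length → path y w t ≠ path y w s) ↔ lastV s w := by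
  simp only [path, lastV, ne_eq, add_right_inj]

lemma take_drop_SS (w : List (Step d)) (s k : ℕ) :
    SS (w.take s) - SS (w.take (s + k)) = -SS ((w.drop s).take k) := by
  rw [List.take_add, SS_append]; abel

lemma sum_even (f : ℕ → ℝ) (hf : ∀ n, 0 ≤ f n) (s M N : ℕ) (h : s + 2 * M ≤ N) :
    ∑ k ∈ Finset.range (M + 1), f (s + 2 * k) ≤ ∑ k ∈ Finset.range (N + 1), f k := by
  rw [← Finset.sum_image (f := f) (g := fun k => s + 2 * k) (s := Finset.range (M + 1))]
  · refine Finset.sum_le_sum_of_subset_of_nonneg ?_ fun _ _ _ => hf _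
    intro k hk
    simp only [Finset.mem_image, Finset.mem_range] at hk ⊢
    omega
  · intro a _ b _ hab
    simp only at hab
    omega

lemma ev_DD (hd : 0 < d) (M : ℕ) (w : List (Step d)) (hw : w.length = 4 * M) :
    ∑ s ∈ Finset.range (2 * M + 1), ev (4 * M) s w * DD M (w.drop s) ≤ 4 * M + 1 := by
  set A := (Finset.range (w.length + 1)).image (path 0 w) with hA
  set N := 4 * M with hN
  have h1 : ∑ k ∈ Finset.range (N + 1), ∑ x ∈ A, av (↑A) N x *
      ∑ u ∈ Finset.range (N + 1), pp u (x - path 0 w k) ≤ ∑ k ∈ Finset.range (N + 1), (1 : ℝ) :=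
    Finset.sum_le_sum fun k _ => last_exit_le hd A N _
  rw [Finset.sum_const, Finset.card_range, nsmul_eq_mul, mul_one, Finset.sum_comm, hA,
    sum_image_last, ← hA, hw] at h1
  have h2 : ((N + 1 : ℕ) : ℝ) = 4 * M + 1 := by rw [hN]; push_cast; ring
  rw [h2] at h1
  refine le_trans ?_ h1
  refine le_trans ?_ (Finset.sum_le_sum_of_subset_of_nonneg
    (s := Finset.range (2 * M + 1)) ?_ ?_)
  · refine Finset.sum_le_sum fun s hs => ?_
    have hs := Finset.mem_range.1 hs
    have := lastV_path 0 w s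
    rw [hw] at this
    simp only [this, ev]
    split_ifs
    · have e := av_path 0 w N s
      rw [← hA] at e
      rw [e, ← Finset.mul_sum]
      refine mul_le_mul_of_nonneg_left ?_ (av_nonneg _ _ _)
      have g0 : ∀ k, 0 ≤ ∑ u ∈ Finset.range (N + 1), pp u (path 0 w s - path 0 w k) :=
        fun k => Finset.sum_nonneg fun u _ => pp_nonneg _ _
      refine le_trans ?_ (sum_even _ g0 s M N (by omega))
      refine Finset.sum_le_sum fun k _ => ?_
      have := sum_even (fun u => pp u (path 0 w s - path 0 w (s + 2 * k)))
        (fun u => pp_nonneg _ _) 0 M N (by omega)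
      refine le_trans (le_of_eq ?_) this
      refine Finset.sum_congr rfl fun u _ => ?_
      simp only [path, zero_add, take_drop_SS, pp_neg]
    · simp
  · intro s hs; simp only [Finset.mem_range] at hs ⊢; omega
  · intro s _ _
    split_ifs
    · exact Finset.sum_nonneg fun k _ => mul_nonneg (av_nonneg _ _ _)
        (Finset.sum_nonneg fun u _ => pp_nonneg _ _)
    · rfl

lemma DD_nonneg (M : ℕ) (w : List (Step d)) : 0 ≤ DD M w :=
  Finset.sum_nonneg fun _ _ => GG_nonneg _ _

lemma ev_pointwise {x D e : ℝ} (hx : 0 ≤ x) (hx1 : x ≤ 1) (hD : 0 ≤ D) (he : 0 < e) :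
    x * (e / 2) ≤ x * D + (2 / e) * (D - e) ^ 2 := by
  have h0 : 0 ≤ (2 / e) * (D - e) ^ 2 := by positivity
  rcases le_or_gt (e / 2) D with h | h
  · have := mul_le_mul_of_nonneg_left h hx
    linarith
  · have h1 : (e / 2) ^ 2 ≤ (D - e) ^ 2 := by nlinarith
    have h2 : e / 2 ≤ (2 / e) * (D - e) ^ 2 := by
      calc e / 2 = (2 / e) * (e / 2) ^ 2 := by field_simp
        _ ≤ _ := by gcongr
    nlinarith [mul_nonneg hx hD]

lemma qq_bound {C c : ℝ} (hd : 0 < d) (hC : 0 < C) (hc : 0 < c)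
    (h : ∀ n (x : Zd d), pp n x ≤ C * xx n ^ 4)
    (h' : ∀ n, c * xx n ^ 4 ≤ pp (2 * n) (0 : Zd d)) (M : ℕ) :
    qq d (4 * M) (4 * M) (4 * M) ≤ (16 / c + 64 * 176 * C ^ 2 / c ^ 2) / ∑ j ∈ Finset.range (M + 1), xx j ^ 2 := by
  set H := ∑ j ∈ Finset.range (M + 1), xx j ^ 2 with hH
  set e := eD d M with he
  set V := 176 * C ^ 2 * H with hV
  set q := qq d (4 * M) (4 * M) (4 * M) with hq
  have Hpos : 0 < H := Finset.sum_pos (fun j _ => pow_pos (xx_pos j) 2) (by simp)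
  have hel : c / 4 * H ≤ e := eD_lower hc h' M
  have epos : 0 < e := lt_of_lt_of_le (by positivity) hel
  have key : ∀ s ∈ Finset.range (2 * M + 1), q * (e / 2) ≤
      EL (4 * M) (fun w : List (Step d) => ev (4 * M) s w * DD M (w.drop s)) + (2 / e) * V := by
    intro s hs
    have hs := Finset.mem_range.1 hs
    have a1 : q ≤ EL (4 * M) (fun w : List (Step d) => ev (4 * M) s w) := by
      have := qq_mono hd (show s ≤ 4 * M by omega) (show 4 * M - s ≤ 4 * M by omega) (4 * M)
      rw [← hq] at this
      refine this.trans (le_of_eq ?_)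
      rw [qq, show s + (4 * M - s) = 4 * M by omega]
    have a2 : EL (4 * M) (fun w : List (Step d) => (DD M (w.drop s) - e) ^ 2) ≤ V := by
      rw [show 4 * M = s + (4 * M - s) by omega, EL_append, ← EL_const hd s V]
      refine EL_mono fun u hu => ?_
      have := var_bound hd hC h (L := s + (4 * M - s) - s) M (by omega)
      refine le_trans (le_of_eq ?_) this
      rw [show s + (4 * M - s) - s = 4 * M - s by omega]
      refine EL_congr fun v _ => ?_
      rw [← hu, List.drop_left]
    calc q * (e / 2) ≤ EL (4 * M) (fun w : List (Step d) => ev (4 * M) s w) * (e / 2) := by gcongr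
      _ = EL (4 * M) (fun w : List (Step d) => ev (4 * M) s w * (e / 2)) := by rw [EL_mul_right]
      _ ≤ EL (4 * M) (fun w : List (Step d) => ev (4 * M) s w * DD M (w.drop s) +
          (2 / e) * (DD M (w.drop s) - e) ^ 2) := EL_mono fun w _ =>
            ev_pointwise (ev_nonneg _ _ _) (ev_le_one hd _ _ _) (DD_nonneg _ _) epos
      _ ≤ _ := by
        rw [EL_add, EL_mul_left]
        gcongr
  have key2 := Finset.sum_le_sum key
  rw [Finset.sum_const, Finset.card_range, nsmul_eq_mul, Finset.sum_add_distrib, Finset.sum_const,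
    Finset.card_range, nsmul_eq_mul, ← EL_sum] at key2
  have key3 : EL (4 * M) (fun w : List (Step d) => ∑ s ∈ Finset.range (2 * M + 1),
      ev (4 * M) s w * DD M (w.drop s)) ≤ 4 * M + 1 := by
    rw [← EL_const (d := d) hd (4 * M) (4 * M + 1 : ℝ)]
    exact EL_mono fun w hw => ev_DD hd M w hw
  have hM : (0:ℝ) < ((2 * M + 1 : ℕ) : ℝ) := by positivity
  have k4 : ((2 * M + 1 : ℕ) : ℝ) * (q * (e / 2)) ≤ ((2 * M + 1 : ℕ) : ℝ) * (2 + (2 / e) * V) := by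
    refine key2.trans ?_
    have : (4 * M + 1 : ℝ) ≤ ((2 * M + 1 : ℕ) : ℝ) * 2 := by push_cast; linarith
    linarith
  have k5 := le_of_mul_le_mul_left k4 hM
  have k6 : q ≤ 4 / e + 4 * V / e ^ 2 := by
    have : q = (q * (e / 2)) * (2 / e) := by field_simp
    rw [this]
    calc (q * (e / 2)) * (2 / e) ≤ (2 + (2 / e) * V) * (2 / e) := by gcongr
      _ = _ := by field_simp; ring
  refine k6.trans ?_
  have k7 : 4 / e ≤ 4 / (c / 4 * H) := by gcongr
  have k8 : 4 * V / e ^ 2 ≤ 4 * V / (c / 4 * H) ^ 2 := by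
    have : 0 ≤ V := by positivity
    gcongr
  refine (add_le_add k7 k8).trans (le_of_eq ?_)
  rw [hV]
  field_simp
  ring

end avoid

/-! ### From measures to words -/

section meas
variable {d : ℕ}

lemma integral_cells {Ω ι : Type*} [MeasurableSpace Ω] [Fintype ι] (μ : Measure Ω)
    [IsProbabilityMeasure μ] (cell : ι → Set Ω) (hm : ∀ i, MeasurableSet (cell i))
    (hdis : Pairwise (Function.onFun Disjoint cell)) (c : ι → ℝ)
    (hc : ∀ i, (μ (cell i)).toReal = c i) (hsum : ∑ i, c i = 1) (F : Ω → ℝ) (f : ι → ℝ)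
    (hF : ∀ i, ∀ ω ∈ cell i, F ω = f i) : ∫ ω, F ω ∂μ = ∑ i, c i * f i := by
  have hU : μ (⋃ i, cell i) = 1 := by
    rw [measure_iUnion hdis hm, tsum_fintype]
    have : (∑ i, μ (cell i)).toReal = 1 := by
      rw [ENNReal.toReal_sum fun i _ => measure_ne_top _ _]
      simp only [hc, hsum]
    rw [← ENNReal.ofReal_toReal (a := ∑ i, μ (cell i)) (by
      exact (ENNReal.sum_lt_top.2 fun i _ => measure_lt_top _ _).ne), this, ENNReal.ofReal_one]
  have hae : ∀ᵐ ω ∂μ, ω ∈ ⋃ i, cell i := by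
    rw [← prob_compl_eq_zero_iff (MeasurableSet.iUnion hm)] at hU
    exact hU
  have e : F =ᵐ[μ] fun ω => ∑ i, (cell i).indicator (fun _ => f i) ω := by
    filter_upwards [hae] with ω hω
    obtain ⟨i, hi⟩ := Set.mem_iUnion.1 hω
    rw [Finset.sum_eq_single i, Set.indicator_of_mem hi, hF i ω hi]
    · intro j _ hj
      refine Set.indicator_of_notMem (fun h => ?_) _
      exact Set.disjoint_left.1 (hdis hj) h hi
    · simp
  rw [integral_congr_ae e, integral_finsetSum]
  · refine Finset.sum_congr rfl fun i _ => ?_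
    rw [integral_indicator_const _ (hm i), smul_eq_mul, Measure.real, hc]
  · intro i _
    exact (integrable_const _).indicator (hm i)

/-- Cylinder of a word. -/
def cyl (x : Zd d) (T : ℕ) (w : List (Step d)) : Set (ℕ → Zd d) := {ω | ∀ t ≤ T, ω t = path x w t}

lemma meas_at (t : ℕ) (y : Zd d) : MeasurableSet {ω : ℕ → Zd d | ω t = y} := by
  have h : Measurable fun ω : ℕ → Zd d => ω t := measurable_pi_apply t
  exact h (measurableSet_singleton y)

lemma cyl_meas (x : Zd d) (T : ℕ) (w : List (Step d)) : MeasurableSet (cyl x T w) := by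
  have : cyl x T w = ⋂ t, ⋂ (_ : t ≤ T), {ω | ω t = path x w t} := by
    ext ω; simp [cyl]
  rw [this]
  refine MeasurableSet.iInter fun t => MeasurableSet.iInter fun _ => ?_
  exact meas_at t (path x w t)

lemma sv_inj : Function.Injective (sv : Step d → Zd d) := by
  rintro ⟨i, a⟩ ⟨j, b⟩ h
  have h1 := congrFun h i
  have h2 := congrFun h j
  simp only [sv, Pi.single_apply] at h1 h2
  by_cases hij : i = j
  · subst hij
    cases a <;> cases b <;> simp_all
  · exfalso
    cases a <;> cases b <;> simp_all

lemma isNN_sv (x : Zd d) (s : Step d) : IsNN x (x + sv s) := by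
  obtain ⟨i, b⟩ := s
  simp only [IsNN, sv, Pi.add_apply]
  rw [Finset.sum_eq_single i]
  · cases b <;> simp
  · intro j _ hj
    simp [Pi.single_apply, hj]
  · simp

lemma path_succ (x : Zd d) (w : List (Step d)) (t : ℕ) (h : t < w.length) :
    path x w (t + 1) = path x w t + sv w[t] := by
  simp only [path]
  rw [List.take_succ_eq_append_getElem h, SS_append]
  simp [add_assoc]

lemma cyl_prob {x : Zd d} {P : Measure (ℕ → Zd d)} (hP : IsSRW d x P) (w : List (Step d)) :
    (P (cyl x w.length w)).toReal = ((2 * d : ℝ)⁻¹) ^ w.length := by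
  rw [cyl, hP.2, if_pos]
  · simp
  · refine ⟨by simp [path], fun t ht => ?_⟩
    rw [path_succ x w t ht]
    exact isNN_sv _ _

lemma path_inj (x : Zd d) {w w' : List (Step d)} (hl : w.length = w'.length)
    (h : ∀ t ≤ w.length, path x w t = path x w' t) : w = w' := by
  refine List.ext_getElem hl fun t h1 h2 => ?_
  have a := h (t + 1) h1
  rw [path_succ x w t h1, path_succ x w' t h2, h t h1.le] at a
  exact sv_inj (add_left_cancel a)

lemma cyl_disj (x : Zd d) (T : ℕ) :
    Pairwise (Function.onFun Disjoint fun w : Fin T → Step d => cyl x T (List.ofFn w)) := by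
  intro a b hab
  refine Set.disjoint_left.2 fun ω h1 h2 => hab ?_
  refine List.ofFn_injective (path_inj x (by simp) fun t ht => ?_)
  rw [List.length_ofFn] at ht
  rw [← h1 t ht, ← h2 t ht]

lemma cyl_sum (hd : 0 < d) (T : ℕ) : ∑ _w : Fin T → Step d, ((2 * d : ℝ)⁻¹) ^ T = 1 := by
  have := EL_const (d := d) hd T 1
  rw [EL_eq_sum, Finset.mul_sum] at this
  simpa using this

lemma cyl_prob' {x : Zd d} {P : Measure (ℕ → Zd d)} (hP : IsSRW d x P) {T : ℕ}
    (w : Fin T → Step d) : (P (cyl x T (List.ofFn w))).toReal = ((2 * d : ℝ)⁻¹) ^ T := by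
  have := cyl_prob hP (List.ofFn w)
  rwa [List.length_ofFn] at this

lemma srw_integral (hd : 0 < d) {x : Zd d} {P : Measure (ℕ → Zd d)} (hP : IsSRW d x P) (T : ℕ)
    (F : (ℕ → Zd d) → ℝ) (f : List (Step d) → ℝ)
    (hF : ∀ w, w.length = T → ∀ ω ∈ cyl x T w, F ω = f w) : ∫ ω, F ω ∂P = EL T f := by
  have := hP.1
  rw [integral_cells P (fun w : Fin T → Step d => cyl x T (List.ofFn w)) (fun w => cyl_meas _ _ _)
    (cyl_disj x T) (fun _ => ((2 * d : ℝ)⁻¹) ^ T) (fun w => cyl_prob' hP w) (cyl_sum hd T) F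
    (fun w => f (List.ofFn w)) (fun w => hF _ (by simp)), EL_eq_sum, Finset.mul_sum]

lemma srw_prob (hd : 0 < d) {x : Zd d} {P : Measure (ℕ → Zd d)} (hP : IsSRW d x P) (T : ℕ)
    (S : Set (ℕ → Zd d)) (hS : MeasurableSet S) (p : List (Step d) → Prop)
    (hF : ∀ w, w.length = T → ∀ ω ∈ cyl x T w, (ω ∈ S ↔ p w)) :
    (P S).toReal = EL T (fun w => if p w then 1 else 0) := by
  have := srw_integral hd hP T (S.indicator 1) (fun w => if p w then 1 else 0) (by
    intro w hw ω hω
    by_cases h : p w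
    · rw [if_pos h, Set.indicator_of_mem ((hF w hw ω hω).2 h)]; rfl
    · rw [if_neg h, Set.indicator_of_notMem (fun h' => h ((hF w hw ω hω).1 h'))])
  rw [integral_indicator_one hS] at this
  exact this

lemma av_eq_EL (A : Set (Zd d)) (m : ℕ) (x : Zd d) :
    EL m (fun w => if ∀ t, 0 < t → t ≤ m → path x w t ∉ A then (1:ℝ) else 0) = av A m x := by
  induction m generalizing x with
  | zero =>
    simp only [EL, av]
    rw [if_pos]
    intro t h1 h2; omega
  | succ m ih =>
    simp only [EL_succ, av_succ]
    congr 1; ext s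
    have key : ∀ w : List (Step d), (∀ t, 0 < t → t ≤ m + 1 → path x (s :: w) t ∉ A) ↔
        (x + sv s ∉ A ∧ ∀ t, 0 < t → t ≤ m → path (x + sv s) w t ∉ A) := by
      intro w
      have e : ∀ t, path x (s :: w) (t + 1) = path (x + sv s) w t := by
        intro t; simp [path, add_assoc]
      constructor
      · intro h
        refine ⟨?_, fun t h1 h2 => ?_⟩
        · have := h 1 (by omega) (by omega)
          rw [e 0] at this
          simpa [path] using this
        · rw [← e]; exact h _ (by omega) (by omega)
      · rintro ⟨h0, h⟩ t h1 h2
        obtain ⟨t, rfl⟩ : ∃ t', t = t' + 1 := ⟨t - 1, by omega⟩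
        rw [e]
        rcases Nat.eq_zero_or_pos t with rfl | h3
        · simpa [path] using h0
        · exact h t h3 (by omega)
    simp only [key]
    by_cases h : x + sv s ∈ A
    · rw [if_pos h]
      simp only [h, not_true_eq_false, false_and, if_false]
      have := EL_mul_left (d := d) m 0 (fun _ => 0)
      simpa using this
    · rw [if_neg h, ← ih]
      simp only [h, not_false_eq_true, true_and]

lemma prob_noReturn (hd : 0 < d) {x : Zd d} {P : Measure (ℕ → Zd d)} (hP : IsSRW d x P)
    (A : Set (Zd d)) (m : ℕ) : (P (NoReturnUpTo A (m : ℝ))).toReal = av A m x := by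
  rw [← av_eq_EL]
  refine srw_prob hd hP m _ ?_ _ ?_
  · have : NoReturnUpTo A (m : ℝ) =
        ⋂ t : ℕ, ⋂ (_ : 0 < t), ⋂ (_ : (t : ℝ) ≤ m), (fun ω : ℕ → Zd d => ω t) ⁻¹' Aᶜ := by
      ext ω; simp [NoReturnUpTo]
    rw [this]
    refine MeasurableSet.iInter fun t => MeasurableSet.iInter fun _ => MeasurableSet.iInter fun _ => ?_
    exact measurable_pi_apply t (MeasurableSet.of_discrete)
  · intro w _ ω hω
    simp only [NoReturnUpTo, Set.mem_ofPred_eq, Nat.cast_le]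
    refine forall_congr' fun t => forall_congr' fun _ => forall_congr' fun ht => ?_
    rw [hω t ht]

lemma prob_at (hd : 0 < d) {x : Zd d} {P : Measure (ℕ → Zd d)} (hP : IsSRW d x P)
    (t : ℕ) (y : Zd d) : (P {ω | ω t = y}).toReal = pp t (y - x) := by
  have := srw_prob hd hP t {ω | ω t = y} ?_ (fun w => SS w = y - x) ?_
  · rw [this, pp]
    refine EL_congr fun w _ => ?_
    split_ifs <;> rfl
  · exact meas_at t y
  · intro w hw ω hω
    simp only [Set.mem_ofPred_eq]
    rw [hω t le_rfl, path, ← hw, List.take_length, eq_sub_iff_add_eq']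

lemma prod_integral (hd : 0 < d) {x y : Zd d} {P P' : Measure (ℕ → Zd d)} (hP : IsSRW d x P)
    (hP' : IsSRW d y P') (Q : Measure ((ℕ → Zd d) × (ℕ → Zd d))) (hQ : IsProdOf Q P P') (T : ℕ)
    (F : (ℕ → Zd d) × (ℕ → Zd d) → ℝ) (f : List (Step d) → List (Step d) → ℝ)
    (hF : ∀ w w', w.length = T → w'.length = T → ∀ p, p.1 ∈ cyl x T w → p.2 ∈ cyl y T w' →
      F p = f w w') : ∫ p, F p ∂Q = EL T (fun w => EL T (fun w' => f w w')) := by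
  have := hQ.1
  rw [integral_cells Q
    (fun w : (Fin T → Step d) × (Fin T → Step d) =>
      cyl x T (List.ofFn w.1) ×ˢ cyl y T (List.ofFn w.2))
    (fun w => (cyl_meas _ _ _).prod (cyl_meas _ _ _)) ?_
    (fun _ => ((2 * d : ℝ)⁻¹) ^ T * ((2 * d : ℝ)⁻¹) ^ T) ?_ ?_ F
    (fun w => f (List.ofFn w.1) (List.ofFn w.2)) ?_]
  · simp only [EL_eq_sum, Finset.mul_sum]
    rw [Fintype.sum_prod_type]
    simp only [mul_assoc]
  · rintro ⟨a, a'⟩ ⟨b, b'⟩ hab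
    refine Set.disjoint_left.2 fun p h1 h2 => hab ?_
    have e1 : a = b := by
      by_contra hne
      exact Set.disjoint_left.1 (cyl_disj x T hne) h1.1 h2.1
    have e2 : a' = b' := by
      by_contra hne
      exact Set.disjoint_left.1 (cyl_disj y T hne) h1.2 h2.2
    rw [e1, e2]
  · intro w
    rw [hQ.2 _ _ (cyl_meas _ _ _) (cyl_meas _ _ _), ENNReal.toReal_mul, cyl_prob' hP, cyl_prob' hP']
  · rw [Fintype.sum_prod_type]
    have : ∀ a : Fin T → Step d, ∑ _b : Fin T → Step d, ((2 * d : ℝ)⁻¹) ^ T * ((2 * d : ℝ)⁻¹) ^ T =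
        ((2 * d : ℝ)⁻¹) ^ T := fun a => by rw [← Finset.mul_sum, cyl_sum hd, mul_one]
    exact (Finset.sum_congr rfl fun a _ => this a).trans (cyl_sum hd T)
  · intro w p hp
    exact hF _ _ (by simp) (by simp) p hp.1 hp.2

lemma walkRange_cyl {x : Zd d} {T : ℕ} {w : List (Step d)} {ω : ℕ → Zd d} (h : ω ∈ cyl x T w) :
    walkRange ω 0 T = (Finset.range (T + 1)).image (path x w) := by
  have e : Finset.Icc 0 T = Finset.range (T + 1) := by ext t; simp
  rw [walkRange, e]
  refine Finset.image_congr fun t ht => ?_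
  simp only [Finset.coe_range, Set.mem_Iio] at ht
  exact h t (by omega)

lemma phi_integral (hd : 0 < d) (P : Zd d → Measure (ℕ → Zd d)) (hP : IsSRWFamily d P) (ρ : ℕ → ℝ)
    (y z : Zd d) (Q : Measure ((ℕ → Zd d) × (ℕ → Zd d))) (hQ : IsProdOf Q (P y) (P z)) (T : ℕ) :
    ∫ p, phiRho P ρ (walkRange p.1 0 T) (walkRange p.2 0 T) ∂Q =
      EL T (fun w => EL T (fun w' => phiRho P ρ ((Finset.range (T + 1)).image (path y w))
        ((Finset.range (T + 1)).image (path z w')))) := by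
  refine prod_integral hd (hP y) (hP z) Q hQ T _ _ ?_
  intro w w' _ _ p h1 h2
  rw [walkRange_cyl h1, walkRange_cyl h2]

end meas

/-! ### Equilibrium weights, Green function, decoupling -/

section weights

variable {ρ : ℕ → ℝ}

lemma summable_mom1 (h0 : IsDist ρ) (h2 : Summable fun l : ℕ => (l : ℝ) ^ 2 * ρ l) :
    Summable fun l : ℕ => (l : ℝ) ^ 1 * ρ l := by
  refine Summable.of_nonneg_of_le (fun l => mul_nonneg (by positivity) (h0.1 l)) (fun l => ?_) h2
  refine mul_le_mul_of_nonneg_right ?_ (h0.1 l)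
  have : l ^ 1 ≤ l ^ 2 := by nlinarith [Nat.zero_le l, Nat.le_self_pow (n := 2) (by norm_num) l]
  exact_mod_cast this

lemma mu_one_nonneg (h0 : IsDist ρ) : 0 ≤ mu 1 ρ :=
  tsum_nonneg fun l => mul_nonneg (by positivity) (h0.1 l)

lemma muTail_summand (h0 : IsDist ρ) (m : ℕ) :
    Summable fun l : ℕ => if m ≤ l then (l : ℝ) ^ 0 * ρ l else 0 := by
  refine Summable.of_nonneg_of_le (fun l => ?_) (fun l => ?_) h0.2.summable
  · split_ifs
    · simpa using h0.1 l
    · rfl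
  · split_ifs
    · simp
    · exact h0.1 l

lemma muTail_nonneg (h0 : IsDist ρ) (m : ℕ) : 0 ≤ muTail 0 m ρ :=
  tsum_nonneg fun l => by
    split_ifs
    · simpa using h0.1 l
    · rfl

lemma muTail_le_one (h0 : IsDist ρ) (m : ℕ) : muTail 0 m ρ ≤ 1 := by
  rw [muTail, ← h0.2.tsum_eq]
  refine (muTail_summand h0 m).tsum_le_tsum (fun l => ?_) h0.2.summable
  split_ifs
  · simp
  · exact h0.1 l

lemma muTail_sum (h0 : IsDist ρ) (h2 : Summable fun l : ℕ => (l : ℝ) ^ 2 * ρ l) (N : ℕ) :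
    ∑ m ∈ Finset.range N, muTail 0 m ρ ≤ mu 1 ρ + 1 := by
  have h1 := summable_mom1 h0 h2
  have e : ∑ m ∈ Finset.range N, muTail 0 m ρ =
      ∑' l : ℕ, ∑ m ∈ Finset.range N, if m ≤ l then (l : ℝ) ^ 0 * ρ l else 0 :=
    (Summable.tsum_finsetSum fun m _ => muTail_summand h0 m).symm
  rw [e, mu, ← h0.2.tsum_eq, ← h1.tsum_add h0.2.summable]
  refine Summable.tsum_le_tsum (fun l => ?_) (summable_sum fun m _ => muTail_summand h0 m)
    (h1.add h0.2.summable)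
  rw [← Finset.sum_filter, Finset.sum_const, nsmul_eq_mul, pow_zero, one_mul, pow_one]
  have hc : ((Finset.range N).filter (fun m => m ≤ l)).card ≤ l + 1 := by
    rw [← Finset.card_range (l + 1)]
    refine Finset.card_le_card fun m hm => ?_
    simp only [Finset.mem_filter, Finset.mem_range] at hm ⊢
    omega
  have hc' : (((Finset.range N).filter (fun m => m ≤ l)).card : ℝ) ≤ l + 1 := by exact_mod_cast hc
  have := mul_le_mul_of_nonneg_right hc' (h0.1 l)
  linarith

end weights

section dec
variable {d : ℕ}

lemma equilRho_eq (hd : 0 < d) {P : Zd d → Measure (ℕ → Zd d)} (hP : IsSRWFamily d P) (ρ : ℕ → ℝ)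
    (A : Set (Zd d)) (x : Zd d) :
    equilRho P ρ A x = ∑' m : ℕ, (muTail 0 m ρ / (mu 1 ρ + 1)) * av A m x := by
  simp only [equilRho, prob_noReturn hd (hP x)]

lemma equilRho_nonneg (hd : 0 < d) {P : Zd d → Measure (ℕ → Zd d)} (hP : IsSRWFamily d P)
    {ρ : ℕ → ℝ} (h0 : IsDist ρ) (A : Set (Zd d)) (x : Zd d) : 0 ≤ equilRho P ρ A x := by
  rw [equilRho_eq hd hP]
  have := mu_one_nonneg h0
  exact tsum_nonneg fun m => mul_nonneg (div_nonneg (muTail_nonneg h0 m) (by linarith))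
    (av_nonneg _ _ _)

lemma equilRho_le (hd : 0 < d) {P : Zd d → Measure (ℕ → Zd d)} (hP : IsSRWFamily d P)
    {ρ : ℕ → ℝ} (h0 : IsDist ρ) (h2 : Summable fun l : ℕ => (l : ℝ) ^ 2 * ρ l)
    (A : Set (Zd d)) (x : Zd d) (r : ℕ) :
    equilRho P ρ A x ≤ r / (mu 1 ρ + 1) + av A r x := by
  rw [equilRho_eq hd hP]
  have hm := mu_one_nonneg h0
  have hm1 : 0 < mu 1 ρ + 1 := by linarith
  refine Real.tsum_le_of_sum_range_le (fun m => mul_nonneg (div_nonneg (muTail_nonneg h0 m) hm1.le)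
    (av_nonneg _ _ _)) fun N => ?_
  calc ∑ m ∈ Finset.range N, (muTail 0 m ρ / (mu 1 ρ + 1)) * av A m x
      ≤ ∑ m ∈ Finset.range N, ((if m < r then 1 / (mu 1 ρ + 1) else 0) +
          (muTail 0 m ρ / (mu 1 ρ + 1)) * av A r x) := by
        refine Finset.sum_le_sum fun m _ => ?_
        have w0 : 0 ≤ muTail 0 m ρ / (mu 1 ρ + 1) := div_nonneg (muTail_nonneg h0 m) hm1.le
        have a0 := av_nonneg A r x
        split_ifs with h
        · have w1 : muTail 0 m ρ / (mu 1 ρ + 1) ≤ 1 / (mu 1 ρ + 1) := by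
            have := muTail_le_one h0 m
            gcongr
          have a1 := av_le_one hd A m x
          have a2 := av_nonneg A m x
          nlinarith [mul_nonneg w0 a0, mul_nonneg w0 (sub_nonneg.2 a1)]
        · have := av_anti hd A (not_lt.1 h) x
          have := mul_le_mul_of_nonneg_left this w0
          linarith
    _ ≤ r / (mu 1 ρ + 1) + av A r x := by
        rw [Finset.sum_add_distrib, ← Finset.sum_mul, ← Finset.sum_div]
        refine add_le_add ?_ ?_
        · rw [← Finset.sum_filter, Finset.sum_const, nsmul_eq_mul, mul_one_div]
          have : ((Finset.range N).filter (fun m => m < r)).card ≤ r := by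
            conv_rhs => rw [← Finset.card_range r]
            refine Finset.card_le_card fun m hm => ?_
            simp only [Finset.mem_filter, Finset.mem_range] at hm ⊢
            omega
          gcongr
        · have : (∑ m ∈ Finset.range N, muTail 0 m ρ) / (mu 1 ρ + 1) ≤ 1 := by
            rw [div_le_one hm1]; exact muTail_sum h0 h2 N
          have := mul_le_mul_of_nonneg_right this (av_nonneg A r x)
          linarith

/-- The Green function. -/
def Gr (x : Zd d) : ℝ := ∑' k, pp k x

lemma green_eq (hd : 0 < d) {P : Zd d → Measure (ℕ → Zd d)} (hP : IsSRWFamily d P) (x y : Zd d) :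
    green P x y = Gr (y - x) := by
  simp only [green, prob_at hd (hP x), Gr]

lemma Gr_nonneg (x : Zd d) : 0 ≤ Gr x := tsum_nonneg fun _ => pp_nonneg _ _

lemma pp_sum_le {C : ℝ} (hd : 4 ≤ d) (hC : 0 < C) (h : ∀ n (x : Zd d), pp n x ≤ C * xx n ^ d)
    (p N : ℕ) (x : Zd d) :
    ∑ k ∈ Finset.range N, pp (p + k) x ≤ 4 * C * xx p ^ (d - 2) := by
  obtain ⟨e, rfl⟩ := Nat.exists_eq_add_of_le' (show 3 ≤ d by omega)
  calc ∑ k ∈ Finset.range N, pp (p + k) x ≤ ∑ k ∈ Finset.range N, C * xx (p + k) ^ (e + 3) :=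
        Finset.sum_le_sum fun k _ => h _ _
    _ = C * ∑ k ∈ Finset.range N, xx (p + k) ^ (e + 3) := by rw [Finset.mul_sum]
    _ ≤ C * (4 * xx p ^ (e + 1)) := by gcongr; exact xx_tail e p N
    _ = _ := by rw [show e + 3 - 2 = e + 1 by omega]; ring

lemma pp_summable {C : ℝ} (hd : 4 ≤ d) (hC : 0 < C) (h : ∀ n (x : Zd d), pp n x ≤ C * xx n ^ d)
    (x : Zd d) : Summable fun k => pp k x := by
  refine summable_of_sum_range_le (c := 4 * C * xx 0 ^ (d - 2)) (fun k => pp_nonneg _ _) fun N => ?_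
  have := pp_sum_le hd hC h 0 N x
  simpa using this

lemma green_avg {C : ℝ} (hd : 4 ≤ d) (hC : 0 < C) (h : ∀ n (x : Zd d), pp n x ≤ C * xx n ^ d)
    (p p' : ℕ) (a b : Zd d) :
    EL p (fun u => EL p' (fun u' => Gr ((b + SS u') - (a + SS u)))) ≤
      4 * C * xx (p + p') ^ (d - 2) := by
  have hs := EL_hasSum p (fun k u => EL p' (fun u' => pp k ((b + SS u') - (a + SS u))))
    (fun u => EL p' (fun u' => Gr ((b + SS u') - (a + SS u)))) fun u =>
      EL_hasSum p' (fun k u' => pp k ((b + SS u') - (a + SS u))) _ fun u' =>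
        (pp_summable hd hC h _).hasSum
  have e : ∀ k, EL p (fun u => EL p' (fun u' => pp k ((b + SS u') - (a + SS u)))) =
      pp (p + p' + k) (b - a) := by
    intro k
    rw [add_assoc, ← EL_pp_sub]
    congr 1; ext u
    rw [← EL_pp_add]
    congr 1; ext u'
    congr 1; abel
  simp only [e] at hs
  rw [← hs.tsum_eq]
  exact Real.tsum_le_of_sum_range_le (fun k => pp_nonneg _ _) fun N => pp_sum_le hd hC h _ N _

lemma decouple {C : ℝ} (hd : 4 ≤ d) (hC : 0 < C) (h : ∀ n (x : Zd d), pp n x ≤ C * xx n ^ d)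
    (p n p' n' : ℕ) (Φ : List (Step d) → List (Step d) → ℝ) (f f' : List (Step d) → ℝ)
    (al be : List (Step d) → Zd d) (hf : ∀ v, 0 ≤ f v) (hf' : ∀ v, 0 ≤ f' v)
    (hΦ : ∀ u v u' v', u.length = p → v.length = n → u'.length = p' → v'.length = n' →
      Φ (u ++ v) (u' ++ v') ≤ f v * f' v' * Gr ((be v' + SS u') - (al v + SS u))) :
    EL (p + n) (fun w => EL (p' + n') (fun w' => Φ w w')) ≤
      EL n f * EL n' f' * (4 * C * xx (p + p') ^ (d - 2)) := by
  set B := 4 * C * xx (p + p') ^ (d - 2) with hB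
  calc EL (p + n) (fun w => EL (p' + n') (fun w' => Φ w w'))
      = EL p (fun u => EL n (fun v => EL p' (fun u' => EL n' (fun v' => Φ (u ++ v) (u' ++ v'))))) := by
        simp only [EL_append]
    _ ≤ EL p (fun u => EL n (fun v => EL p' (fun u' => EL n' (fun v' =>
          f v * f' v' * Gr ((be v' + SS u') - (al v + SS u)))))) :=
        EL_mono fun u hu => EL_mono fun v hv => EL_mono fun u' hu' => EL_mono fun v' hv' =>
          hΦ u v u' v' hu hv hu' hv'
    _ = EL n (fun v => EL n' (fun v' => f v * f' v' *
          EL p (fun u => EL p' (fun u' => Gr ((be v' + SS u') - (al v + SS u)))))) := by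
        rw [EL_comm p n]
        congr 1; ext v
        have : ∀ u : List (Step d), EL p' (fun u' => EL n' (fun v' =>
            f v * f' v' * Gr ((be v' + SS u') - (al v + SS u)))) =
            EL n' (fun v' => EL p' (fun u' =>
            f v * f' v' * Gr ((be v' + SS u') - (al v + SS u)))) := fun u => EL_comm _ _ _
        simp only [this]
        rw [EL_comm p n']
        simp only [EL_mul_left]
    _ ≤ EL n (fun v => EL n' (fun v' => f v * f' v' * B)) :=
        EL_mono fun v _ => EL_mono fun v' _ =>
          mul_le_mul_of_nonneg_left (green_avg hd hC h p p' _ _) (mul_nonneg (hf v) (hf' v'))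
    _ = _ := by
        simp only [EL_mul_right, EL_mul_left]

/-- Local factor. -/
def ZZ (δ : ℝ) (T r s : ℕ) (w : List (Step d)) : ℝ :=
  if r ≤ s ∧ s + r ≤ T then δ + ev r s w else 1

/-- Decoupled local factor. -/
def Zf (δ : ℝ) (T r s : ℕ) (v : List (Step d)) : ℝ :=
  if r ≤ s ∧ s + r ≤ T then δ + ev r r (v.take (r + r)) else 1

/-- Mean local factor. -/
def Zq (d : ℕ) (δ : ℝ) (T r s : ℕ) : ℝ :=
  if r ≤ s ∧ s + r ≤ T then δ + qq d r r r else 1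

lemma Zf_nonneg {δ : ℝ} (hδ : 0 ≤ δ) (T r s : ℕ) (v : List (Step d)) : 0 ≤ Zf δ T r s v := by
  unfold Zf; split_ifs
  · exact add_nonneg hδ (ev_nonneg _ _ _)
  · exact zero_le_one

lemma ZZ_nonneg {δ : ℝ} (hδ : 0 ≤ δ) (T r s : ℕ) (v : List (Step d)) : 0 ≤ ZZ δ T r s v := by
  unfold ZZ; split_ifs
  · exact add_nonneg hδ (ev_nonneg _ _ _)
  · exact zero_le_one

lemma Zf_mean (hd : 0 < d) (δ : ℝ) (T r s : ℕ) :
    EL (T - (s - r)) (fun v : List (Step d) => Zf δ T r s v) = Zq d δ T r s := by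
  unfold Zf Zq
  split_ifs with h
  · rw [EL_add, EL_const hd, EL_take hd (by omega) (fun v => ev r r v), qq]
  · exact EL_const hd _ _

lemma ZZ_le (δ : ℝ) (T r s : ℕ) (hs : s ≤ T) (u v : List (Step d)) (hu : u.length = s - r)
    (hv : v.length = T - (s - r)) : ZZ δ T r s (u ++ v) ≤ Zf δ T r s v := by
  unfold ZZ Zf
  split_ifs with h
  · have := ev_mid r r u (v.take (r + r)) (v.drop (r + r)) (by simp; omega)
    rw [List.take_append_drop, hu, show s - r + r = s by omega] at this
    linarith
  · rfl

lemma phi_le_ZZ (hd : 0 < d) {P : Zd d → Measure (ℕ → Zd d)} (hP : IsSRWFamily d P)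
    {ρ : ℕ → ℝ} (h0 : IsDist ρ) (h2 : Summable fun l : ℕ => (l : ℝ) ^ 2 * ρ l) (T r : ℕ)
    (y z : Zd d) (w w' : List (Step d)) (hw : w.length = T) (hw' : w'.length = T) :
    phiRho P ρ ((Finset.range (T + 1)).image (path y w)) ((Finset.range (T + 1)).image (path z w')) ≤
      ∑ s ∈ Finset.range (T + 1), ∑ t ∈ Finset.range (T + 1),
        ZZ (r / (mu 1 ρ + 1)) T r s w * ZZ (r / (mu 1 ρ + 1)) T r t w' *
          Gr (path z w' t - path y w s) := by
  set δ : ℝ := r / (mu 1 ρ + 1) with hδ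
  have hm := mu_one_nonneg h0
  have δ0 : 0 ≤ δ := by positivity
  have key : ∀ (y : Zd d) (w : List (Step d)), w.length = T → ∀ s,
      (if ∀ t, s < t → t ≤ T → path y w t ≠ path y w s then
        equilRho P ρ (↑((Finset.range (T + 1)).image (path y w))) (path y w s) else 0) ≤
      ZZ δ T r s w := by
    intro y w hw s
    by_cases hl : ∀ t, s < t → t ≤ T → path y w t ≠ path y w s
    · rw [if_pos hl]
      have hl' : lastV s w := by rw [← lastV_path y, hw]; exact hl
      unfold ZZ
      split_ifs with h
      · refine (equilRho_le hd hP h0 h2 _ _ r).trans ?_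
        have := av_path y w r s
        rw [hw] at this
        rw [this, ev, if_pos hl']
      · refine (equilRho_le hd hP h0 h2 _ _ 0).trans ?_
        simp [av]
    · rw [if_neg hl]; exact ZZ_nonneg δ0 _ _ _ _
  simp only [phiRho, green_eq hd hP]
  rw [sum_image_last]
  refine Finset.sum_le_sum fun s _ => ?_
  rw [sum_image_last]
  have k1 := key y w hw s
  have k0 : 0 ≤ ZZ δ T r s w := ZZ_nonneg δ0 _ _ _ _
  split_ifs at k1 ⊢ with h
  · refine Finset.sum_le_sum fun t _ => ?_
    have k2 := key z w' hw' t
    split_ifs at k2 ⊢ with h'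
    · have := Gr_nonneg (path z w' t - path y w s)
      have e1 := equilRho_nonneg hd hP h0 (↑((Finset.range (T + 1)).image (path y w))) (path y w s)
      have e2 := equilRho_nonneg hd hP h0 (↑((Finset.range (T + 1)).image (path z w'))) (path z w' t)
      gcongr
    · exact mul_nonneg (mul_nonneg k0 k2) (Gr_nonneg _)
  · exact Finset.sum_nonneg fun t _ =>
      mul_nonneg (mul_nonneg k0 (ZZ_nonneg δ0 _ _ _ _)) (Gr_nonneg _)

lemma phi_main {C : ℝ} (hd : 4 ≤ d) (hC : 0 < C) (h : ∀ n (x : Zd d), pp n x ≤ C * xx n ^ d)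
    {P : Zd d → Measure (ℕ → Zd d)} (hP : IsSRWFamily d P)
    {ρ : ℕ → ℝ} (h0 : IsDist ρ) (h2 : Summable fun l : ℕ => (l : ℝ) ^ 2 * ρ l) (T r : ℕ)
    (y z : Zd d) (Q : Measure ((ℕ → Zd d) × (ℕ → Zd d))) (hQ : IsProdOf Q (P y) (P z)) :
    ∫ p, phiRho P ρ (walkRange p.1 0 T) (walkRange p.2 0 T) ∂Q ≤
      ∑ s ∈ Finset.range (T + 1), ∑ t ∈ Finset.range (T + 1),
        Zq d (r / (mu 1 ρ + 1)) T r s * Zq d (r / (mu 1 ρ + 1)) T r t *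
          (4 * C * xx ((s - r) + (t - r)) ^ (d - 2)) := by
  have hd0 : 0 < d := by omega
  set δ : ℝ := r / (mu 1 ρ + 1) with hδ
  have hm := mu_one_nonneg h0
  have δ0 : 0 ≤ δ := by positivity
  rw [phi_integral hd0 P hP ρ y z Q hQ T]
  refine le_trans (EL_mono fun w hw => EL_mono fun w' hw' => phi_le_ZZ hd0 hP h0 h2 T r y z w w' hw hw') ?_
  rw [← hδ]
  simp only [EL_sum]
  refine Finset.sum_le_sum fun s hs => Finset.sum_le_sum fun t ht => ?_
  have hs := Finset.mem_range.1 hs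
  have ht := Finset.mem_range.1 ht
  have := decouple hd hC h (s - r) (T - (s - r)) (t - r) (T - (t - r))
    (fun w w' => ZZ δ T r s w * ZZ δ T r t w' * Gr (path z w' t - path y w s))
    (Zf δ T r s) (Zf δ T r t) (fun v => y + SS (v.take (s - (s - r))))
    (fun v => z + SS (v.take (t - (t - r)))) (Zf_nonneg δ0 _ _ _) (Zf_nonneg δ0 _ _ _) (by
      intro u v u' v' hu hv hu' hv'
      have a1 := ZZ_le δ T r s (by omega) u v hu hv
      have a2 := ZZ_le δ T r t (by omega) u' v' hu' hv'
      have a3 := ZZ_nonneg δ0 T r s (u ++ v)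
      have a4 := ZZ_nonneg δ0 T r t (u' ++ v')
      have pe : ∀ (x : Zd d) (u v : List (Step d)) (s : ℕ), u.length = s - r →
          path x (u ++ v) s = x + SS (v.take (s - (s - r))) + SS u := by
        intro x u v s hu
        have := take_pre u v (s - (s - r))
        rw [hu, show s - r + (s - (s - r)) = s by omega] at this
        rw [path, this]; abel
      simp only [pe z u' v' t hu', pe y u v s hu]
      have := Gr_nonneg (z + SS (v'.take (t - (t - r))) + SS u' - (y + SS (v.take (s - (s - r))) + SS u))
      have := a3.trans a1
      gcongr)
  rw [Zf_mean hd0, Zf_mean hd0, show s - r + (T - (s - r)) = T by omega,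
    show t - r + (T - (t - r)) = T by omega] at this
  exact this

end dec

/-! ### Final estimates -/

section final
variable {d : ℕ}

lemma qq_nonneg (d a b m : ℕ) : 0 ≤ qq d a b m := EL_nonneg fun w _ => ev_nonneg _ _ _

lemma qq_le_one (hd : 0 < d) (a b m : ℕ) : qq d a b m ≤ 1 := by
  rw [← EL_const (d := d) hd (a + b) 1]
  exact EL_mono fun w _ => ev_le_one hd _ _ _

lemma Zq_nonneg {δ : ℝ} (hδ : 0 ≤ δ) (T r s : ℕ) : 0 ≤ Zq d δ T r s := by
  unfold Zq; split_ifs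
  · exact add_nonneg hδ (qq_nonneg _ _ _ _)
  · exact zero_le_one

lemma Zq_le_one (hd : 0 < d) (T r s : ℕ) : Zq d 0 T r s ≤ 1 := by
  unfold Zq; split_ifs
  · rw [zero_add]; exact qq_le_one hd _ _ _
  · exact le_rfl

/-- Basic bound in dimensions at least five. -/
lemma phi_high {C : ℝ} (hd : 5 ≤ d) (hC : 0 < C) (h : ∀ n (x : Zd d), pp n x ≤ C * xx n ^ d)
    {P : Zd d → Measure (ℕ → Zd d)} (hP : IsSRWFamily d P)
    {ρ : ℕ → ℝ} (h0 : IsDist ρ) (h2 : Summable fun l : ℕ => (l : ℝ) ^ 2 * ρ l) (T : ℕ)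
    (y z : Zd d) (Q : Measure ((ℕ → Zd d) × (ℕ → Zd d))) (hQ : IsProdOf Q (P y) (P z)) :
    ∫ p, phiRho P ρ (walkRange p.1 0 T) (walkRange p.2 0 T) ∂Q ≤
      16 * C * ∑ s ∈ Finset.range (T + 1), xx s ^ (d - 4) := by
  refine (phi_main (by omega) hC h hP h0 h2 T 0 y z Q hQ).trans ?_
  rw [Finset.mul_sum]
  refine Finset.sum_le_sum fun s _ => ?_
  obtain ⟨e, rfl⟩ := Nat.exists_eq_add_of_le' hd
  calc ∑ t ∈ Finset.range (T + 1), Zq (e + 5) ((0 : ℕ) / (mu 1 ρ + 1)) T 0 s *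
        Zq (e + 5) ((0 : ℕ) / (mu 1 ρ + 1)) T 0 t * (4 * C * xx ((s - 0) + (t - 0)) ^ (e + 5 - 2))
      ≤ ∑ t ∈ Finset.range (T + 1), 1 * 1 * (4 * C * xx (s + t) ^ (e + 3)) := by
        refine Finset.sum_le_sum fun t _ => ?_
        simp only [Nat.cast_zero, zero_div, Nat.sub_zero]
        rw [show e + 5 - 2 = e + 3 by omega]
        have a1 := Zq_le_one (d := e + 5) (by omega) T 0 s
        have a2 := Zq_le_one (d := e + 5) (by omega) T 0 t
        have a3 := Zq_nonneg (d := e + 5) le_rfl T 0 t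
        have := xx_pos (s + t)
        gcongr
    _ = 4 * C * ∑ t ∈ Finset.range (T + 1), xx (s + t) ^ (e + 3) := by
        rw [Finset.mul_sum]; simp only [one_mul]
    _ ≤ 4 * C * (4 * xx s ^ (e + 1)) := by gcongr; exact xx_tail e s (T + 1)
    _ = _ := by rw [show e + 5 - 4 = e + 1 by omega]; ring

lemma Zq_sum {q : ℝ} (T r : ℕ) (δ : ℝ) (hq0 : 0 ≤ q) (hq : δ + qq d r r r ≤ q) :
    ∑ s ∈ Finset.range (T + 1), Zq d δ T r s * xx (s - r) ≤
      q * (2 * Real.sqrt (T + 1)) + 2 * r := by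
  calc ∑ s ∈ Finset.range (T + 1), Zq d δ T r s * xx (s - r)
      ≤ ∑ s ∈ Finset.range (T + 1), (q * (if r ≤ s then xx (s - r) else 0) +
          ((if s < r then 1 else 0) + (if T < s + r then 1 else 0))) := by
        refine Finset.sum_le_sum fun s _ => ?_
        have x0 := (xx_pos (s - r)).le
        have x1 := xx_le_one (s - r)
        unfold Zq
        by_cases h1 : r ≤ s
        · by_cases h2 : s + r ≤ T
          · rw [if_pos ⟨h1, h2⟩, if_pos h1, if_neg (by omega), if_neg (by omega)]
            have := mul_le_mul_of_nonneg_right hq x0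
            linarith
          · rw [if_neg (fun h => h2 h.2), if_pos h1, if_neg (by omega), if_pos (by omega)]
            have := mul_nonneg hq0 x0
            linarith
        · rw [if_neg (fun h => h1 h.1), if_neg h1, if_pos (by omega)]
          split_ifs <;> linarith
    _ = q * (∑ s ∈ Finset.range (T + 1), if r ≤ s then xx (s - r) else 0) +
          (∑ s ∈ Finset.range (T + 1), (if s < r then (1:ℝ) else 0) +
           ∑ s ∈ Finset.range (T + 1), (if T < s + r then (1:ℝ) else 0)) := by
        rw [Finset.sum_add_distrib, Finset.sum_add_distrib, Finset.mul_sum]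
    _ ≤ q * (2 * Real.sqrt (T + 1)) + (r + r) := by
        have a1 : (∑ s ∈ Finset.range (T + 1), if r ≤ s then xx (s - r) else 0) ≤
            2 * Real.sqrt (T + 1) := by
          have := xx_sum (T + 1)
          push_cast at this
          refine le_trans ?_ this
          rw [← Finset.sum_filter]
          rw [← Finset.sum_image (f := xx) (g := fun s => s - r)]
          · refine Finset.sum_le_sum_of_subset_of_nonneg ?_ fun _ _ _ => (xx_pos _).le
            intro k hk
            simp only [Finset.mem_image, Finset.mem_range, Finset.mem_filter] at hk ⊢
            omega
          · intro a ha b hb hab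
            simp only [Finset.coe_filter, Finset.mem_range, Set.mem_ofPred_eq] at ha hb hab
            omega
        have a2 : ∑ s ∈ Finset.range (T + 1), (if s < r then (1:ℝ) else 0) ≤ r := by
          rw [← Finset.sum_filter, Finset.sum_const, nsmul_eq_mul, mul_one]
          have : ((Finset.range (T + 1)).filter (fun s => s < r)).card ≤ (Finset.range r).card := by
            refine Finset.card_le_card fun m hm => ?_
            simp only [Finset.mem_filter, Finset.mem_range] at hm ⊢
            omega
          rw [Finset.card_range] at this
          exact_mod_cast this
        have a3 : ∑ s ∈ Finset.range (T + 1), (if T < s + r then (1:ℝ) else 0) ≤ r := by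
          rw [← Finset.sum_filter, Finset.sum_const, nsmul_eq_mul, mul_one]
          have : ((Finset.range (T + 1)).filter (fun s => T < s + r)).card ≤
              (Finset.Ico (T + 1 - r) (T + 1)).card := by
            refine Finset.card_le_card fun m hm => ?_
            simp only [Finset.mem_filter, Finset.mem_range, Finset.mem_Ico] at hm ⊢
            omega
          rw [Nat.card_Ico] at this
          have : ((Finset.range (T + 1)).filter (fun s => T < s + r)).card ≤ r := by omega
          exact_mod_cast this
        gcongr
    _ = _ := by ring

/-- Basic bound in dimension four. -/
lemma phi_four {C : ℝ} (hC : 0 < C) (h : ∀ n (x : Zd 4), pp n x ≤ C * xx n ^ 4)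
    {P : Zd 4 → Measure (ℕ → Zd 4)} (hP : IsSRWFamily 4 P)
    {ρ : ℕ → ℝ} (h0 : IsDist ρ) (h2 : Summable fun l : ℕ => (l : ℝ) ^ 2 * ρ l) (T r : ℕ) {q : ℝ}
    (hq : r / (mu 1 ρ + 1) + qq 4 r r r ≤ q)
    (y z : Zd 4) (Q : Measure ((ℕ → Zd 4) × (ℕ → Zd 4))) (hQ : IsProdOf Q (P y) (P z)) :
    ∫ p, phiRho P ρ (walkRange p.1 0 T) (walkRange p.2 0 T) ∂Q ≤
      4 * C * (q * (2 * Real.sqrt (T + 1)) + 2 * r) ^ 2 := by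
  refine (phi_main le_rfl hC h hP h0 h2 T r y z Q hQ).trans ?_
  have hm := mu_one_nonneg h0
  set δ : ℝ := r / (mu 1 ρ + 1) with hδ
  have δ0 : 0 ≤ δ := by positivity
  have q0 : 0 ≤ q := (add_nonneg δ0 (qq_nonneg _ _ _ _)).trans hq
  have hz := Zq_sum (d := 4) T r δ q0 hq
  calc ∑ s ∈ Finset.range (T + 1), ∑ t ∈ Finset.range (T + 1),
        Zq 4 δ T r s * Zq 4 δ T r t * (4 * C * xx ((s - r) + (t - r)) ^ (4 - 2))
      ≤ ∑ s ∈ Finset.range (T + 1), ∑ t ∈ Finset.range (T + 1),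
        4 * C * ((Zq 4 δ T r s * xx (s - r)) * (Zq 4 δ T r t * xx (t - r))) := by
        refine Finset.sum_le_sum fun s _ => Finset.sum_le_sum fun t _ => ?_
        have := xx_mul (s - r) (t - r)
        have b1 := Zq_nonneg (d := 4) δ0 T r s
        have b2 := Zq_nonneg (d := 4) δ0 T r t
        calc Zq 4 δ T r s * Zq 4 δ T r t * (4 * C * xx ((s - r) + (t - r)) ^ (4 - 2))
            ≤ Zq 4 δ T r s * Zq 4 δ T r t * (4 * C * (xx (s - r) * xx (t - r))) := by
              gcongr
          _ = _ := by ring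
    _ = 4 * C * (∑ s ∈ Finset.range (T + 1), Zq 4 δ T r s * xx (s - r)) ^ 2 := by
        rw [sq, Finset.sum_mul_sum]
        simp only [Finset.mul_sum]
    _ ≤ _ := by
        have : 0 ≤ ∑ s ∈ Finset.range (T + 1), Zq 4 δ T r s * xx (s - r) :=
          Finset.sum_nonneg fun s _ => mul_nonneg (Zq_nonneg δ0 _ _ _) (xx_pos _).le
        gcongr

lemma one_le_log {R : ℕ} (hR : 3 ≤ R) : 1 ≤ Real.log R := by
  rw [Real.le_log_iff_exp_le (by positivity)]
  have h := Real.exp_one_lt_d9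
  have : (3:ℝ) ≤ R := by exact_mod_cast hR
  linarith

lemma T_le {K : ℝ} (hK : 0 < K) {R : ℕ} (hR : 3 ≤ R) :
    (⌊K * (R : ℝ) ^ 2⌋₊ : ℝ) + 1 ≤ (K + 1) * (R : ℝ) ^ 2 := by
  have h1 : (⌊K * (R : ℝ) ^ 2⌋₊ : ℝ) ≤ K * (R : ℝ) ^ 2 := Nat.floor_le (by positivity)
  have : (3:ℝ) ≤ R := by exact_mod_cast hR
  nlinarith

lemma sqrtT_le {K : ℝ} (hK : 0 < K) {R : ℕ} (hR : 3 ≤ R) :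
    Real.sqrt ((⌊K * (R : ℝ) ^ 2⌋₊ : ℝ) + 1) ≤ Real.sqrt (K + 1) * R := by
  refine (Real.sqrt_le_sqrt (T_le hK hR)).trans (le_of_eq ?_)
  rw [Real.sqrt_mul (by linarith), Real.sqrt_sq (by positivity)]

/-- The numerical bound on the mean factor in dimension four. -/
lemma q_bound {c1 μ : ℝ} (hc1 : 0 ≤ c1) {R M : ℕ} (hR : 3 ≤ R) (hM : M = Nat.sqrt R)
    (hμ : (R : ℝ) ^ 2 ≤ μ)
    (hq : qq 4 (4 * M) (4 * M) (4 * M) ≤ c1 / ∑ j ∈ Finset.range (M + 1), xx j ^ 2) :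
    ((4 * M : ℕ) : ℝ) / (μ + 1) + qq 4 (4 * M) (4 * M) (4 * M) ≤ (4 + 2 * c1) / Real.log R := by
  have hL := one_le_log hR
  set L := Real.log R with hLd
  have hR0 : (3:ℝ) ≤ R := by exact_mod_cast hR
  have hLR : L ≤ R := by
    have := Real.log_le_sub_one_of_pos (show (0:ℝ) < R by linarith)
    linarith
  have hMR : (M : ℝ) ≤ R := by
    rw [hM]; exact_mod_cast Nat.sqrt_le_self R
  have a1 : ((4 * M : ℕ) : ℝ) / (μ + 1) ≤ 4 / L := by
    rw [div_le_div_iff₀ (by nlinarith) (by linarith)]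
    push_cast
    have : (M : ℝ) * L ≤ R * R := by gcongr
    nlinarith
  have hH : L / 2 ≤ ∑ j ∈ Finset.range (M + 1), xx j ^ 2 := by
    rw [harm_eq]
    refine le_trans ?_ (log_add_one_le_harmonic (M + 1))
    have h1 : R < (M + 1) * (M + 1) := by rw [hM]; exact Nat.lt_succ_sqrt R
    have h2 : (R : ℝ) ≤ ((M : ℝ) + 1) ^ 2 := by
      have : (R : ℝ) ≤ ((M + 1) * (M + 1) : ℕ) := by exact_mod_cast h1.le
      push_cast at this
      nlinarith
    have h3 : L ≤ 2 * Real.log ((M : ℝ) + 1) := by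
      have := Real.log_le_log (by linarith) h2
      rw [Real.log_pow] at this
      exact_mod_cast this
    have h4 : Real.log ((M : ℝ) + 1) ≤ Real.log (((M + 1 : ℕ) : ℝ) + 1) := by
      refine Real.log_le_log (by positivity) ?_
      push_cast; linarith
    push_cast at h4 ⊢
    linarith
  have a2 : c1 / ∑ j ∈ Finset.range (M + 1), xx j ^ 2 ≤ c1 / (L / 2) := by
    gcongr
  calc _ ≤ 4 / L + c1 / (L / 2) := by linarith
    _ = _ := by field_simp

lemma M_bound {R M : ℕ} (hR : 3 ≤ R) (hM : M = Nat.sqrt R) :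
    2 * ((4 * M : ℕ) : ℝ) ≤ 16 * (R / Real.log R) := by
  have hL := one_le_log hR
  have hR0 : (3:ℝ) ≤ R := by exact_mod_cast hR
  have h1 : (M : ℝ) ≤ Real.sqrt R := by
    refine Real.le_sqrt_of_sq_le ?_
    have : M ^ 2 ≤ R := by rw [hM, sq]; exact Nat.sqrt_le R
    exact_mod_cast this
  have hs : 0 < Real.sqrt R := Real.sqrt_pos.2 (by linarith)
  have h2 : Real.log R ≤ 2 * Real.sqrt R := by
    have := Real.log_le_sub_one_of_pos hs
    rw [Real.log_sqrt (by linarith)] at this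
    linarith
  have h3 : Real.sqrt R ≤ 2 * (R / Real.log R) := by
    rw [mul_div_assoc', le_div_iff₀ (by linarith)]
    nlinarith [Real.mul_self_sqrt (show (0:ℝ) ≤ R by linarith)]
  push_cast
  linarith

end final

/-- **Lemma 5.7.** There is `C` such that for all large `n` and all starting points
`y, z`, two independent simple random walks satisfy
`E[φ^{(ρ_n)}(X¹[0,KR_n²], X²[0,KR_n²])] ≤ C R_n² (log R_n)^{-2}` if `d = 4`,
`≤ C R_n` if `d = 5`, `≤ C log R_n` if `d = 6`, and `≤ C` if `d > 6`. -/
theorem expected_phi_of_two_walks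
    (d : ℕ) (hd : 4 ≤ d) (ρ : ℕ → ℕ → ℝ) (hρ : Appropriate ρ)
    (Pw : Zd d → Measure (ℕ → Zd d)) (hPw : IsSRWFamily d Pw)
    (K : ℝ) (hK : 0 < K) :
    ∃ C : ℝ, 0 < C ∧ ∀ᶠ n in atTop,
      ∀ y z : Zd d, ∀ Q : Measure ((ℕ → Zd d) × (ℕ → Zd d)),
        IsProdOf Q (Pw y) (Pw z) →
        (∫ p, phiRho Pw (ρ n) (walkRange p.1 0 ⌊K * (Rn ρ n : ℝ) ^ 2⌋₊)
            (walkRange p.2 0 ⌊K * (Rn ρ n : ℝ) ^ 2⌋₊) ∂ Q) ≤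
          (if d = 4 then C * (Rn ρ n : ℝ) ^ 2 / (Real.log (Rn ρ n)) ^ 2
           else if d = 5 then C * (Rn ρ n : ℝ)
           else if d = 6 then C * Real.log (Rn ρ n) else C) := by
  have hd0 : 0 < d := by omega
  obtain ⟨h0, h2, hmu, -⟩ := hρ
  have hev : ∀ᶠ n in atTop, 3 ≤ Rn ρ n ∧ ((Rn ρ n : ℝ)) ^ 2 ≤ mu 1 (ρ n) := by
    filter_upwards [hmu.eventually_ge_atTop 9] with n hn
    refine ⟨?_, ?_⟩
    · refine Nat.le_floor ?_
      refine Real.le_sqrt_of_sq_le ?_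
      push_cast
      linarith
    · have h1 : (Rn ρ n : ℝ) ≤ Real.sqrt (mu 1 (ρ n)) := Nat.floor_le (Real.sqrt_nonneg _)
      calc ((Rn ρ n : ℝ)) ^ 2 ≤ Real.sqrt (mu 1 (ρ n)) ^ 2 := by gcongr
        _ = _ := Real.sq_sqrt (by linarith)
  obtain ⟨C, hC, hCp⟩ := pp_upper (d := d) hd0
  have hK1 : 0 < Real.sqrt (K + 1) := Real.sqrt_pos.2 (by linarith)
  by_cases h4 : d = 4
  · subst h4
    obtain ⟨c, hc, hcp⟩ := pp_lower (d := 4) hd0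
    set c1 := 16 / c + 64 * 176 * C ^ 2 / c ^ 2 with hc1
    have c1pos : 0 < c1 := by positivity
    set B := 2 * (4 + 2 * c1) * Real.sqrt (K + 1) + 16 with hB
    have Bpos : 0 < B := by positivity
    refine ⟨4 * C * B ^ 2, by positivity, ?_⟩
    filter_upwards [hev] with n hn y z Q hQ
    rw [if_pos rfl]
    obtain ⟨hR, hRμ⟩ := hn
    set R := Rn ρ n with hRd
    have hL := one_le_log hR
    have hq := q_bound c1pos.le hR rfl hRμ (qq_bound hd0 hC hc hCp hcp (Nat.sqrt R))
    refine (phi_four hC hCp hPw (h0 n) (h2 n) _ _ hq y z Q hQ).trans ?_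
    have hM := M_bound hR rfl
    have hT := sqrtT_le hK hR
    have e : (4 + 2 * c1) / Real.log R * (2 * Real.sqrt ((⌊K * (R : ℝ) ^ 2⌋₊ : ℝ) + 1)) +
        2 * ((4 * Nat.sqrt R : ℕ) : ℝ) ≤ B * (R / Real.log R) := by
      calc _ ≤ (4 + 2 * c1) / Real.log R * (2 * (Real.sqrt (K + 1) * R)) +
            16 * (R / Real.log R) := by gcongr
        _ = _ := by rw [hB]; ring
    calc _ ≤ 4 * C * (B * (R / Real.log R)) ^ 2 := by gcongr
      _ = _ := by rw [mul_pow, div_pow]; ring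
  · have hd5 : 5 ≤ d := by omega
    set C1 := 16 * C * (2 * Real.sqrt (K + 1)) with hC1
    set C2 := 16 * C * (3 + Real.log (K + 1)) with hC2
    have hlK : 0 < Real.log (K + 1) := Real.log_pos (by linarith)
    refine ⟨C1 + C2 + 64 * C, by positivity, ?_⟩
    have C1pos : 0 < C1 := by positivity
    have C2pos : 0 < C2 := by positivity
    filter_upwards [hev] with n hn y z Q hQ
    rw [if_neg h4]
    obtain ⟨hR, hRμ⟩ := hn
    refine (phi_high hd5 hC hCp hPw (h0 n) (h2 n) _ y z Q hQ).trans ?_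
    set R := Rn ρ n with hRd
    have hL := one_le_log hR
    have hR0 : (3:ℝ) ≤ R := by exact_mod_cast hR
    set T := ⌊K * (R : ℝ) ^ 2⌋₊ with hT
    by_cases h5 : d = 5
    · rw [if_pos h5]
      subst h5
      have a1 := xx_sum (T + 1)
      have a2 := sqrtT_le hK hR
      push_cast at a1
      simp only [show 5 - 4 = 1 by norm_num, pow_one]
      calc 16 * C * ∑ s ∈ Finset.range (T + 1), xx s ≤ 16 * C * (2 * (Real.sqrt (K + 1) * R)) := by
            gcongr; linarith
        _ = C1 * R := by rw [hC1]; ring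
        _ ≤ _ := by gcongr; linarith
    · rw [if_neg h5]
      by_cases h6 : d = 6
      · rw [if_pos h6]
        subst h6
        simp only [show 6 - 4 = 2 by norm_num, harm_eq]
        have a1 := harmonic_le_one_add_log (T + 1)
        have a2 := T_le hK hR
        have a3 : Real.log ((T + 1 : ℕ) : ℝ) ≤ Real.log (K + 1) + 2 * Real.log R := by
          have : Real.log ((T + 1 : ℕ) : ℝ) ≤ Real.log ((K + 1) * (R : ℝ) ^ 2) :=
            Real.log_le_log (by positivity) (by push_cast; exact a2)
          rw [Real.log_mul (by linarith) (by positivity), Real.log_pow] at this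
          exact_mod_cast this
        have a4 : (harmonic (T + 1) : ℝ) ≤ (3 + Real.log (K + 1)) * Real.log R := by
          nlinarith
        calc 16 * C * (harmonic (T + 1) : ℝ) ≤ 16 * C * ((3 + Real.log (K + 1)) * Real.log R) := by
              gcongr
          _ = C2 * Real.log R := by rw [hC2]; ring
          _ ≤ _ := by gcongr; linarith
      · rw [if_neg h6]
        have a1 : ∑ s ∈ Finset.range (T + 1), xx s ^ (d - 4) ≤ 4 := by
          calc ∑ s ∈ Finset.range (T + 1), xx s ^ (d - 4) ≤
                ∑ s ∈ Finset.range (T + 1), xx (0 + s) ^ (0 + 3) := by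
                refine Finset.sum_le_sum fun s _ => ?_
                rw [zero_add]
                exact pow_le_pow_of_le_one (xx_pos s).le (xx_le_one s) (by omega)
            _ ≤ 4 * xx 0 ^ (0 + 1) := xx_tail 0 0 (T + 1)
            _ ≤ 4 := by have := xx_le_one 0; simp only [zero_add, pow_one]; linarith
        calc _ ≤ 16 * C * 4 := by gcongr
          _ ≤ _ := by linarith

end FRIPaper
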